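/- Hook-length formula for the specialized coefficients: Let n ≥ 1 and let λ, μ, ν be partitions with at most n parts such that λ ⊆ ν and μ ⊆ ν. Then f^ν_{λμ} = Σ_{ρ : λ ⊆ ρ, μ ⊆ ρ, ρ ⊆ ν} (−1)^{|ν|−|ρ|} · h(ρ) / ( h(ν/ρ)·h(ρ/λ)·h(ρ/μ) ), an equality of rational numbers, where the sum is over all partitions ρ containing both λ and μ and contained in ν. -/

import Mathlib

open scoped BigOperators

namespace FactorialLR

/-- Column order on cells: right-most column first, top to bottom within a column. -/
def ColLT (a b : ℕ × ℕ) : Prop :=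
  b.2 < a.2 ∨ (a.2 = b.2 ∧ a.1 < b.1)

instance (a b : ℕ × ℕ) : Decidable (ColLT a b) := by
  unfold ColLT; infer_instance

/-- The cells of the skew diagram `θo / θi`. -/
def skewCells (θi θo : YoungDiagram) : Finset (ℕ × ℕ) :=
  θo.cells \ θi.cells

/-- A filling of the cell set `s` with entries in `Fin n` (`0`-based, representing the
`1`-based entries `{1,…,n}`) is semistandard if it weakly increases along rows and strictly
increases down columns. -/
def IsSsyt {n : ℕ} (s : Finset (ℕ × ℕ)) (T : s → Fin n) : Prop :=
  (∀ c c' : s, (c : ℕ × ℕ).1 = (c' : ℕ × ℕ).1 → (c : ℕ × ℕ).2 ≤ (c' : ℕ × ℕ).2 → T c ≤ T c') ∧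
  (∀ c c' : s, (c : ℕ × ℕ).1 < (c' : ℕ × ℕ).1 → (c : ℕ × ℕ).2 = (c' : ℕ × ℕ).2 → T c < T c')

/-- `μ → ν` : `ν` is obtained from `μ` by adding a single cell. -/
def Covers (μ ν : YoungDiagram) : Prop :=
  μ ≤ ν ∧ ν.card = μ.card + 1

/-- Chains `μ = ρ⁽⁰⁾ → ρ⁽¹⁾ → ⋯ → ρ⁽ˡ⁾ = ν` of Young diagrams, encoded as lists. -/
def chainSet (μ ν : YoungDiagram) : Set (List YoungDiagram) :=
  {L | L.Chain' Covers ∧ L.head? = some μ ∧ L.getLast? = some ν}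

/-- The row (`0`-based) of the unique cell of `τ / σ`, when `σ → τ`. -/
def stepRow (σ τ : YoungDiagram) : ℕ :=
  (τ.cells \ σ.cells).sup Prod.fst

/-- The set `𝒯(θ,R)` for a sequence `R` (encoded as the list `L`): pairs `(T,β)` where `T`
is a semistandard filling of `s` and `β` lists the barred cells `α_1 < ⋯ < α_l` in column
order, with `T(α_i) = r_i` (the row of `ρ⁽ⁱ⁾/ρ⁽ⁱ⁻¹⁾`). -/
def TSet {n : ℕ} (s : Finset (ℕ × ℕ)) (L : List YoungDiagram) :
    Set ((s → Fin n) × (Fin (L.length - 1) → s)) :=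
  {p | IsSsyt s p.1 ∧
    (∀ i j : Fin (L.length - 1), i < j → ColLT (p.2 i : ℕ × ℕ) (p.2 j : ℕ × ℕ)) ∧
    (∀ i : Fin (L.length - 1),
      (p.1 (p.2 i) : ℕ) = stepRow (L.getD (i : ℕ) ⊥) (L.getD ((i : ℕ) + 1) ⊥))}

/-- For an unbarred cell `c`, `ρ(c) = ρ⁽ⁱ⁾` where `i` is maximal with `α_i < c` in
column order, i.e. `i` is the number of barred cells preceding `c`. -/
def rhoOf {s : Finset (ℕ × ℕ)} (L : List YoungDiagram)
    (β : Fin (L.length - 1) → s) (c : s) : YoungDiagram :=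
  L.getD ((Finset.univ.filter
    (fun i : Fin (L.length - 1) => ColLT (β i : ℕ × ℕ) (c : ℕ × ℕ))).card) ⊥

/-- The specialized factorial Littlewood–Richardson coefficient
`f^ν_{λμ} = Σ_{T ∈ 𝒯(λ,ν/μ)} ∏_{α unbarred} (ρ(α)_{T(α)} + n − 2 T(α) − c(α) + 1)`,
where `T(α)` is the `1`-based entry and `ρ(α)_{T(α)}` the `T(α)`-th part of `ρ(α)`. -/
noncomputable def fcoef (n : ℕ) (lam μ ν : YoungDiagram) : ℤ :=
  ∑ᶠ L ∈ chainSet μ ν,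
    ∑ᶠ p ∈ TSet (n := n) lam.cells L,
      ∏ c : lam.cells,
        if ∃ i, p.2 i = c then 1
        else ((rhoOf L p.2 c).rowLen (p.1 c) : ℤ) + (n : ℤ) - 2 * ((p.1 c : ℤ) + 1)
              - (((c : ℕ × ℕ).2 : ℤ) - ((c : ℕ × ℕ).1 : ℤ)) + 1

/-- The number of standard Young tableaux of skew shape `ν/μ`: bijective fillings of the
cells of `ν/μ` by `{1,…,l}` that strictly increase along rows and down columns. -/
noncomputable def dimSkew (μ ν : YoungDiagram) : ℕ :=
  Nat.card {T : skewCells μ ν → Fin (ν.card - μ.card) //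
    Function.Bijective T ∧
    (∀ c c' : skewCells μ ν,
      (c : ℕ × ℕ).1 = (c' : ℕ × ℕ).1 → (c : ℕ × ℕ).2 < (c' : ℕ × ℕ).2 → T c < T c') ∧
    (∀ c c' : skewCells μ ν,
      (c : ℕ × ℕ).1 < (c' : ℕ × ℕ).1 → (c : ℕ × ℕ).2 = (c' : ℕ × ℕ).2 → T c < T c')}

/-- `h(ν/μ) = |ν/μ|! / dim(ν/μ)`. -/
noncomputable def hk (μ ν : YoungDiagram) : ℚ :=
  (Nat.factorial (ν.card - μ.card) : ℚ) / (dimSkew μ ν : ℚ)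



end FactorialLR

namespace FactorialLR
open MvPolynomial

/-- dominance of column sets -/
def Dom {n : ℕ} (δ γ : Finset (Fin n)) : Prop :=
  ∀ v : Fin n, (γ.filter (· ≤ v)).card ≤ (δ.filter (· ≤ v)).card

instance {n : ℕ} (δ γ : Finset (Fin n)) : Decidable (Dom δ γ) := by
  unfold Dom; infer_instance

def pos {n : ℕ} (δ : Finset (Fin n)) (v : Fin n) : ℕ := (δ.filter (· < v)).card

def bw {n : ℕ} (j : ℕ) (δ : Finset (Fin n)) (v : Fin n) : ℚ := (v : ℕ) + j - pos δ v

noncomputable def colW {n : ℕ} (j : ℕ) (δ : Finset (Fin n)) : MvPolynomial (Fin n) ℚ :=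
  ∏ v ∈ δ, (X v - C (bw j δ v))

noncomputable def Z {n : ℕ} (h : ℕ → ℕ) : ℕ → Finset (Fin n) → MvPolynomial (Fin n) ℚ
  | 0, _ => 1
  | j + 1, γ => ∑ δ ∈ Finset.univ.filter (fun δ : Finset (Fin n) => δ.card = h j ∧ Dom δ γ),
      colW j δ * Z h j δ

section sym
variable {n : ℕ} {p q : Fin n}

def sw (p q : Fin n) (δ : Finset (Fin n)) : Finset (Fin n) := δ.map (Equiv.swap p q).toEmbedding

lemma mem_sw {δ : Finset (Fin n)} {v : Fin n} : v ∈ sw p q δ ↔ Equiv.swap p q v ∈ δ := by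
  unfold sw
  rw [Finset.mem_map_equiv, Equiv.symm_swap]

lemma sw_sw (δ : Finset (Fin n)) : sw p q (sw p q δ) = δ := by
  ext v; simp [mem_sw]

lemma card_sw (δ : Finset (Fin n)) : (sw p q δ).card = δ.card := by simp [sw]

lemma card_filter_sw (δ : Finset (Fin n)) (P : Fin n → Prop) [DecidablePred P]
    (hP : P p ↔ P q) : ((sw p q δ).filter P).card = (δ.filter P).card := by
  have : (sw p q δ).filter P = sw p q (δ.filter P) := by
    ext v
    simp only [Finset.mem_filter, mem_sw]
    by_cases h1 : v = p
    · subst h1; simp [hP]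
    by_cases h2 : v = q
    · subst h2; simp [hP]
    rw [Equiv.swap_apply_of_ne_of_ne h1 h2]
  rw [this, card_sw]

lemma filter_le_sw (hpq : (p : ℕ) + 1 = q) (δ : Finset (Fin n)) {v : Fin n} (hv : v ≠ p) :
    ((sw p q δ).filter (· ≤ v)).card = (δ.filter (· ≤ v)).card := by
  apply card_filter_sw
  have : (v : ℕ) ≠ p := fun h => hv (Fin.ext h)
  simp only [Fin.le_def]; omega

lemma pos_sw (hpq : (p : ℕ) + 1 = q) (δ : Finset (Fin n)) {v : Fin n} (hv : v ≠ q) :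
    pos (sw p q δ) v = pos δ v := by
  apply card_filter_sw
  have : (v : ℕ) ≠ q := fun h => hv (Fin.ext h)
  simp only [Fin.lt_def]; omega

lemma pos_succ (hpq : (p : ℕ) + 1 = q) (δ : Finset (Fin n)) :
    pos δ q = pos δ p + if p ∈ δ then 1 else 0 := by
  unfold pos
  have : δ.filter (· < q) = δ.filter (· < p) ∪ δ.filter (· = p) := by
    ext v
    simp only [Finset.mem_filter, Finset.mem_union, Fin.lt_def, Fin.ext_iff, ← and_or_left]
    refine and_congr_right fun _ => ?_
    omega
  rw [this, Finset.card_union_of_disjoint]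
  · congr 1
    rw [Finset.filter_eq']
    split_ifs <;> simp
  · rw [Finset.disjoint_filter]
    intro x _ h1 h2
    subst h2; exact lt_irrefl _ h1

lemma filter_le_eq_pos (δ : Finset (Fin n)) (p : Fin n) :
    (δ.filter (· ≤ p)).card = pos δ p + if p ∈ δ then 1 else 0 := by
  unfold pos
  have : δ.filter (· ≤ p) = δ.filter (· < p) ∪ δ.filter (· = p) := by
    ext v
    simp only [Finset.mem_filter, Finset.mem_union, le_iff_lt_or_eq, ← and_or_left]
  rw [this, Finset.card_union_of_disjoint]
  · congr 1
    rw [Finset.filter_eq']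
    split_ifs <;> simp
  · rw [Finset.disjoint_filter]
    intro x _ h1 h2
    subst h2; exact lt_irrefl _ h1

/-- the algebra map swapping two variables -/
noncomputable def sr (p q : Fin n) : MvPolynomial (Fin n) ℚ →ₐ[ℚ] MvPolynomial (Fin n) ℚ :=
  rename (Equiv.swap p q)

lemma sr_X (v : Fin n) : sr p q (X v) = X (Equiv.swap p q v) := by simp [sr]
lemma sr_C (c : ℚ) : sr p q (C c) = C c := by simp [sr]
lemma sr_sr (f : MvPolynomial (Fin n) ℚ) : sr p q (sr p q f) = f := by
  simp only [sr, rename_rename]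
  have : (⇑(Equiv.swap p q) ∘ ⇑(Equiv.swap p q)) = id := by funext x; simp
  rw [this, rename_id_apply]

/-- common part of the weight -/
noncomputable def rest (p q : Fin n) (j : ℕ) (δ : Finset (Fin n)) : MvPolynomial (Fin n) ℚ :=
  ∏ v ∈ (δ.erase p).erase q, (X v - C (bw j δ v))

lemma rest_sw (hpq : (p : ℕ) + 1 = q) (j : ℕ) (δ : Finset (Fin n)) :
    rest p q j (sw p q δ) = rest p q j δ := by
  unfold rest
  have : ((sw p q δ).erase p).erase q = (δ.erase p).erase q := by
    ext v
    simp only [Finset.mem_erase, mem_sw]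
    refine and_congr_right fun h1 => and_congr_right fun h2 => ?_
    rw [Equiv.swap_apply_of_ne_of_ne h2 h1]
  rw [this]
  refine Finset.prod_congr rfl fun v hv => ?_
  simp only [Finset.mem_erase] at hv
  unfold bw; rw [pos_sw hpq δ hv.1]

lemma sr_rest (j : ℕ) (δ : Finset (Fin n)) : sr p q (rest p q j δ) = rest p q j δ := by
  unfold rest
  rw [map_prod]
  refine Finset.prod_congr rfl fun v hv => ?_
  simp only [Finset.mem_erase] at hv
  rw [map_sub, sr_X, sr_C, Equiv.swap_apply_of_ne_of_ne hv.2.1 hv.1]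

lemma colW_none {j : ℕ} {δ : Finset (Fin n)} (hp : p ∉ δ) (hq : q ∉ δ) :
    colW j δ = rest p q j δ := by
  unfold colW rest
  rw [Finset.erase_eq_of_notMem hp, Finset.erase_eq_of_notMem hq]

lemma colW_p {j : ℕ} {δ : Finset (Fin n)} (hp : p ∈ δ) (hq : q ∉ δ) :
    colW j δ = (X p - C (bw j δ p)) * rest p q j δ := by
  unfold colW rest
  rw [Finset.erase_eq_of_notMem (s := δ.erase p) (by simp [hq]), Finset.mul_prod_erase _ (fun v => X v - C (bw j δ v)) hp]

lemma colW_q {j : ℕ} {δ : Finset (Fin n)} (hp : p ∉ δ) (hq : q ∈ δ) :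
    colW j δ = (X q - C (bw j δ q)) * rest p q j δ := by
  unfold colW rest
  rw [Finset.erase_eq_of_notMem hp, Finset.mul_prod_erase _ (fun v => X v - C (bw j δ v)) hq]

lemma colW_pq {j : ℕ} {δ : Finset (Fin n)} (hpq : p ≠ q) (hp : p ∈ δ) (hq : q ∈ δ) :
    colW j δ = (X p - C (bw j δ p)) * ((X q - C (bw j δ q)) * rest p q j δ) := by
  unfold colW rest
  rw [Finset.mul_prod_erase (δ.erase p) (fun v => X v - C (bw j δ v)) (by simp [hq, hpq.symm]), Finset.mul_prod_erase _ (fun v => X v - C (bw j δ v)) hp]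

lemma sw_eq_self {δ : Finset (Fin n)} (h : p ∈ δ ↔ q ∈ δ) : sw p q δ = δ := by
  ext v
  rw [mem_sw]
  by_cases h1 : v = p
  · subst h1; simp [h]
  by_cases h2 : v = q
  · subst h2; simp [h]
  rw [Equiv.swap_apply_of_ne_of_ne h1 h2]

lemma bw_q_of_sw (hpq : (p : ℕ) + 1 = q) (j : ℕ) {ε : Finset (Fin n)} (hp : p ∈ ε) (hq : q ∉ ε) :
    bw j (sw p q ε) q = bw j ε p + 1 := by
  unfold bw
  have hne : p ≠ q := fun h => by subst h; omega
  rw [pos_succ hpq, pos_sw hpq _ hne, if_neg (by simp [mem_sw, hq]), ← hpq]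
  push_cast; ring

lemma bw_q_both (hpq : (p : ℕ) + 1 = q) (j : ℕ) {ε : Finset (Fin n)} (hp : p ∈ ε) :
    bw j ε q = bw j ε p := by
  unfold bw
  rw [pos_succ hpq, if_pos hp, ← hpq]
  push_cast; ring

/-- the inductive statement about `Z` -/
def SymStmt (p q : Fin n) (h : ℕ → ℕ) (j : ℕ) : Prop :=
  (∀ γ, (p ∈ γ → q ∈ γ) → sr p q (Z h j γ) = Z h j γ) ∧
  (∀ γ, p ∈ γ → q ∉ γ → (X p - X q) * (Z h j (sw p q γ) - Z h j γ) =
    (X q - C (bw j γ p)) * (Z h j γ - sr p q (Z h j γ)))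

lemma X_sub_ne (hpq : p ≠ q) : (X p - X q : MvPolynomial (Fin n) ℚ) ≠ 0 := by
  intro h
  exact hpq (X_injective (sub_eq_zero.mp h))

lemma term_tight (hpq : (p : ℕ) + 1 = q) {h : ℕ → ℕ} {j : ℕ} (ih : SymStmt p q h j)
    {ε : Finset (Fin n)} (hp : p ∈ ε) (hq : q ∉ ε) :
    (X p - X q) * (colW j (sw p q ε) * Z h j (sw p q ε)) =
    (X q - C (bw j ε p + 1)) * (colW j ε * Z h j ε - sr p q (colW j ε * Z h j ε)) := by
  have h1 := ih.2 ε hp hq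
  have hp' : p ∉ sw p q ε := by simp [mem_sw, hq]
  have hq' : q ∈ sw p q ε := by simp [mem_sw, hp]
  rw [colW_q hp' hq', colW_p hp hq, rest_sw hpq, bw_q_of_sw hpq j hp hq, map_mul, map_mul,
    sr_rest, map_sub, sr_X, sr_C, Equiv.swap_apply_left]
  linear_combination ((X q - C (bw j ε p + 1)) * rest p q j ε) * h1

lemma pair_sum' (hpq : (p : ℕ) + 1 = q) {h : ℕ → ℕ} {j : ℕ} (ih : SymStmt p q h j)
    {ε : Finset (Fin n)} (hp : p ∈ ε) (hq : q ∉ ε) :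
    sr p q (colW j ε * Z h j ε + colW j (sw p q ε) * Z h j (sw p q ε)) =
      colW j ε * Z h j ε + colW j (sw p q ε) * Z h j (sw p q ε) := by
  have hne : p ≠ q := fun h => by subst h; omega
  have h1 := ih.2 ε hp hq
  have hp' : p ∉ sw p q ε := by simp [mem_sw, hq]
  have hq' : q ∈ sw p q ε := by simp [mem_sw, hp]
  have h2 := ih.1 (sw p q ε) (fun h => absurd h hp')
  apply mul_left_cancel₀ (X_sub_ne hne)
  rw [colW_q hp' hq', colW_p hp hq, rest_sw hpq, bw_q_of_sw hpq j hp hq, map_add]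
  simp only [map_mul, map_sub, sr_rest, sr_X, sr_C, Equiv.swap_apply_left, Equiv.swap_apply_right,
    h2]
  have h3 : (C (bw j ε p + 1) : MvPolynomial (Fin n) ℚ) = C (bw j ε p) + 1 := by simp
  linear_combination (rest p q j ε * (X p - X q)) * h1

lemma pair_sum (hpq : (p : ℕ) + 1 = q) {h : ℕ → ℕ} {j : ℕ} (ih : SymStmt p q h j)
    (ε : Finset (Fin n)) :
    sr p q (colW j ε * Z h j ε + colW j (sw p q ε) * Z h j (sw p q ε)) =
      colW j ε * Z h j ε + colW j (sw p q ε) * Z h j (sw p q ε) := by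
  have hne : p ≠ q := fun h => by subst h; omega
  by_cases hp : p ∈ ε <;> by_cases hq : q ∈ ε
  · rw [sw_eq_self (by simp [hp, hq])]
    have h2 := ih.1 ε (fun _ => hq)
    rw [colW_pq hne hp hq, bw_q_both hpq j hp, map_add]
    simp only [map_mul, map_sub, sr_rest, sr_X, sr_C, Equiv.swap_apply_left,
      Equiv.swap_apply_right, h2]
    ring
  · exact pair_sum' hpq ih hp hq
  · have := pair_sum' hpq ih (ε := sw p q ε) (by simp [mem_sw, hq]) (by simp [mem_sw, hp])
    rw [sw_sw] at this
    rw [add_comm]; exact this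
  · rw [sw_eq_self (by simp [hp, hq])]
    have h2 := ih.1 ε (fun h => absurd h hp)
    rw [colW_none hp hq, map_add, map_mul, sr_rest, h2]

lemma sum_sym (hpq : (p : ℕ) + 1 = q) {h : ℕ → ℕ} {j : ℕ} (ih : SymStmt p q h j)
    (D : Finset (Finset (Fin n))) (hD : ∀ δ ∈ D, sw p q δ ∈ D) :
    sr p q (∑ δ ∈ D, colW j δ * Z h j δ) = ∑ δ ∈ D, colW j δ * Z h j δ := by
  have e : ∑ δ ∈ D, colW j (sw p q δ) * Z h j (sw p q δ) = ∑ δ ∈ D, colW j δ * Z h j δ :=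
    Finset.sum_nbij' (sw p q) (sw p q) hD hD (fun _ _ => sw_sw _) (fun _ _ => sw_sw _)
      (fun _ _ => rfl)
  have h2 : sr p q (∑ δ ∈ D, (colW j δ * Z h j δ + colW j (sw p q δ) * Z h j (sw p q δ))) =
      ∑ δ ∈ D, (colW j δ * Z h j δ + colW j (sw p q δ) * Z h j (sw p q δ)) := by
    rw [map_sum]
    exact Finset.sum_congr rfl fun δ _ => pair_sum hpq ih δ
  rw [Finset.sum_add_distrib, e, map_add, ← two_mul, ← two_mul] at h2
  exact mul_left_cancel₀ two_ne_zero h2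

lemma dom_sw (hpq : (p : ℕ) + 1 = q) {δ γ : Finset (Fin n)} (hγ : p ∈ γ → q ∈ γ)
    (hd : Dom δ γ) : Dom (sw p q δ) γ := by
  intro v
  have hne : p ≠ q := fun h => by subst h; omega
  by_cases hv : v = p
  · subst hv
    have e1 := filter_le_sw hpq δ hne.symm
    have e2 := hd q
    have e4 := pos_sw hpq δ hne
    have e5 : pos γ v ≤ pos δ v := by
      rcases Nat.eq_zero_or_pos (v : ℕ) with h0 | h0
      · have : pos γ v = 0 := by
          unfold pos
          rw [Finset.card_eq_zero, Finset.filter_eq_empty_iff]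
          intro x _ hx; rw [Fin.lt_def] at hx; omega
        omega
      · have h3 := hd ⟨v - 1, by omega⟩
        have key : ∀ s : Finset (Fin n), s.filter (· ≤ (⟨(v : ℕ) - 1, by omega⟩ : Fin n)) =
            s.filter (· < v) := by
          intro s; apply Finset.filter_congr; intro x _
          simp only [Fin.le_def, Fin.lt_def]; omega
        rw [key, key] at h3; exact h3
    simp only [filter_le_eq_pos, pos_succ hpq, e4] at e1 e2 ⊢
    by_cases h1 : v ∈ γ
    · simp only [h1, hγ h1, if_true] at e1 e2 ⊢
      split_ifs at e1 e2 ⊢ <;> omega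
    · simp only [h1, if_false]
      omega
  · rw [filter_le_sw hpq δ hv]; exact hd v

theorem symStmt (hpq : (p : ℕ) + 1 = q) (h : ℕ → ℕ) (j : ℕ) : SymStmt p q h j := by
  have hne : p ≠ q := fun h => by subst h; omega
  induction j with
  | zero => constructor <;> intros <;> simp [Z]
  | succ j ih =>
    refine ⟨fun γ hγ => ?_, fun γ hp hq => ?_⟩
    · simp only [Z]
      apply sum_sym hpq ih
      intro δ hδ
      simp only [Finset.mem_filter, Finset.mem_univ, true_and] at hδ ⊢
      exact ⟨by rw [card_sw, hδ.1], dom_sw hpq hγ hδ.2⟩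
    · have hp' : p ∉ sw p q γ := by simp [mem_sw, hq]
      have hq' : q ∈ sw p q γ := by simp [mem_sw, hp]
      set D := Finset.univ.filter (fun δ : Finset (Fin n) => δ.card = h j ∧ Dom δ γ) with hD
      set D' := Finset.univ.filter
        (fun δ : Finset (Fin n) => δ.card = h j ∧ Dom δ (sw p q γ)) with hD'
      have hle : ∀ v, ((sw p q γ).filter (· ≤ v)).card ≤ (γ.filter (· ≤ v)).card := by
        intro v
        by_cases hv : v = p
        · subst hv
          rw [filter_le_eq_pos, filter_le_eq_pos, pos_sw hpq _ hne]
          simp [hp']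
        · rw [filter_le_sw hpq γ hv]
      have hsub : D ⊆ D' := by
        intro δ hδ
        simp only [hD, hD', Finset.mem_filter, Finset.mem_univ, true_and] at hδ ⊢
        exact ⟨hδ.1, fun v => (hle v).trans (hδ.2 v)⟩
      have hsym : sr p q (∑ δ ∈ D', colW j δ * Z h j δ) = ∑ δ ∈ D', colW j δ * Z h j δ := by
        apply sum_sym hpq ih
        intro δ hδ
        simp only [hD', Finset.mem_filter, Finset.mem_univ, true_and] at hδ ⊢
        exact ⟨by rw [card_sw, hδ.1], dom_sw hpq (fun h => absurd h hp') hδ.2⟩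
      have e1 : Z h (j + 1) γ = ∑ δ ∈ D, colW j δ * Z h j δ := rfl
      have e2 : Z h (j + 1) (sw p q γ) = ∑ δ ∈ D', colW j δ * Z h j δ := rfl
      have e3 := Finset.sum_sdiff (f := fun δ => colW j δ * Z h j δ) hsub
      have e4 : (X p - X q) * ∑ δ ∈ D' \ D, colW j δ * Z h j δ =
          - (X q - C (bw (j+1) γ p)) * ((∑ δ ∈ D' \ D, colW j δ * Z h j δ) -
            sr p q (∑ δ ∈ D' \ D, colW j δ * Z h j δ)) := by
        rw [map_sum, ← Finset.sum_sub_distrib, Finset.mul_sum, Finset.mul_sum]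
        refine Finset.sum_congr rfl fun δ hδ => ?_
        simp only [hD, hD', Finset.mem_sdiff, Finset.mem_filter, Finset.mem_univ, true_and,
          not_and] at hδ
        obtain ⟨⟨hc, hd'⟩, hnd⟩ := hδ
        have hnd := hnd hc
        have hfail : (δ.filter (· ≤ p)).card < (γ.filter (· ≤ p)).card := by
          by_contra hcon
          apply hnd
          intro v
          by_cases hv : v = p
          · subst hv; omega
          · have := hd' v
            rwa [filter_le_sw hpq γ hv] at this
        have a1 := hd' q
        have a2 := hd' p
        rw [filter_le_sw hpq γ hne.symm] at a1
        simp only [filter_le_eq_pos, pos_succ hpq, pos_sw hpq γ hne, if_pos hp, if_neg hq,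
          if_neg hp'] at a1 a2 hfail
        have hpδ : p ∉ δ := by
          intro hpd; rw [if_pos hpd] at *
          have e5 : pos γ p ≤ pos δ p := by
            rcases Nat.eq_zero_or_pos (p : ℕ) with h0 | h0
            · have : pos γ p = 0 := by
                unfold pos
                rw [Finset.card_eq_zero, Finset.filter_eq_empty_iff]
                intro x _ hx; rw [Fin.lt_def] at hx; omega
              omega
            · have h3 := hd' ⟨p - 1, by omega⟩
              rw [filter_le_sw hpq γ (by intro h; rw [Fin.ext_iff] at h; simp at h; omega)] at h3
              have key : ∀ s : Finset (Fin n), s.filter (· ≤ (⟨(p : ℕ) - 1, by omega⟩ : Fin n)) =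
                  s.filter (· < p) := by
                intro s; apply Finset.filter_congr; intro x _
                simp only [Fin.le_def, Fin.lt_def]; omega
              rw [key, key] at h3; exact h3
          omega
        rw [if_neg hpδ] at *
        have hqδ : q ∈ δ := by
          by_contra hqd; rw [if_neg hqd] at *; omega
        have hpos : pos δ p = pos γ p := by omega
        have t := term_tight hpq ih (ε := sw p q δ) (by simp [mem_sw, hqδ]) (by simp [mem_sw, hpδ])
        have t2 := pair_sum hpq ih δ
        rw [map_add] at t2
        rw [sw_sw] at t
        have hb : bw (j+1) γ p = bw j (sw p q δ) p + 1 := by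
          unfold bw; rw [pos_sw hpq δ hne, hpos]; push_cast; ring
        rw [t, hb]
        linear_combination (X q - C (bw j (sw p q δ) p + 1)) * (-t2)
      rw [e1, e2]
      rw [← e3, map_add] at hsym
      rw [← e3]
      linear_combination e4 + (X q - C (bw (j+1) γ p)) * hsym
end sym
end FactorialLR

namespace FactorialLR

lemma yd_le_iff {μ ν : YoungDiagram} : μ ≤ ν ↔ ∀ i, μ.rowLen i ≤ ν.rowLen i := by
  constructor
  · intro h i
    by_contra hc
    have h1 : (i, ν.rowLen i) ∈ μ := by rw [YoungDiagram.mem_iff_lt_rowLen]; omega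
    have h2 : (i, ν.rowLen i) ∈ ν := h h1
    rw [YoungDiagram.mem_iff_lt_rowLen] at h2; omega
  · intro h c hc
    obtain ⟨i, j⟩ := c
    have h1 : (i, j) ∈ μ := hc
    show (i, j) ∈ ν
    rw [YoungDiagram.mem_iff_lt_rowLen] at h1 ⊢
    exact h1.trans_le (h i)

lemma yd_ext {μ ν : YoungDiagram} (h : ∀ i, μ.rowLen i = ν.rowLen i) : μ = ν :=
  le_antisymm (yd_le_iff.2 fun i => (h i).le) (yd_le_iff.2 fun i => (h i).ge)

lemma rowLen_eq_zero_of {μ : YoungDiagram} {n i : ℕ} (h : μ.colLen 0 ≤ n) (hi : n ≤ i) :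
    μ.rowLen i = 0 := by
  by_contra hc
  have h1 : (i, 0) ∈ μ := by rw [YoungDiagram.mem_iff_lt_rowLen]; omega
  rw [YoungDiagram.mem_iff_lt_colLen] at h1; omega

lemma colLen_le_of {μ : YoungDiagram} {n : ℕ} (h : μ.rowLen n = 0) : μ.colLen 0 ≤ n := by
  by_contra hc
  have h1 : (n, 0) ∈ μ := by rw [YoungDiagram.mem_iff_lt_colLen]; omega
  rw [YoungDiagram.mem_iff_lt_rowLen] at h1; omega

lemma colLen_mono {μ ν : YoungDiagram} {n : ℕ} (h : μ ≤ ν) (hν : ν.colLen 0 ≤ n) :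
    μ.colLen 0 ≤ n := by
  apply colLen_le_of
  have := yd_le_iff.1 h n
  rw [rowLen_eq_zero_of hν le_rfl] at this; omega

lemma card_eq_sum {μ : YoungDiagram} {n : ℕ} (h : μ.colLen 0 ≤ n) :
    μ.card = ∑ i ∈ Finset.range n, μ.rowLen i := by
  rw [YoungDiagram.card, Finset.card_eq_sum_card_fiberwise (f := Prod.fst) (t := Finset.range n)]
  · refine Finset.sum_congr rfl fun i _ => ?_
    rw [YoungDiagram.rowLen_eq_card]; rfl
  · intro c hc
    obtain ⟨i, j⟩ := c
    have h1 : (i, j) ∈ μ := by simpa using hc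
    simp only [Finset.coe_range, Set.mem_Iio]
    by_contra hi
    rw [YoungDiagram.mem_iff_lt_rowLen, rowLen_eq_zero_of h (by omega)] at h1
    omega

def Addable (μ : YoungDiagram) (r : ℕ) : Prop := r = 0 ∨ μ.rowLen r < μ.rowLen (r - 1)

instance (μ : YoungDiagram) (r : ℕ) : Decidable (Addable μ r) := by
  unfold Addable; infer_instance

def addBox (μ : YoungDiagram) (r : ℕ) : YoungDiagram :=
  if h : Addable μ r then
    ⟨insert (r, μ.rowLen r) μ.cells, by
      intro a b hba ha
      obtain ⟨a1, a2⟩ := a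
      obtain ⟨b1, b2⟩ := b
      simp only [Prod.mk_le_mk] at hba
      simp only [Finset.coe_insert, Set.mem_insert_iff, Prod.mk.injEq, Finset.mem_coe,
        YoungDiagram.mem_cells, YoungDiagram.mem_iff_lt_rowLen] at ha ⊢
      rcases ha with ⟨rfl, rfl⟩ | ha
      · rcases eq_or_ne b1 a1 with rfl | hne
        · omega
        · right
          unfold Addable at h
          have h3 := μ.rowLen_anti b1 (a1 - 1) (by omega)
          omega
      · right
        have := μ.rowLen_anti b1 a1 hba.1
        omega⟩
  else μ

lemma cells_addBox {μ : YoungDiagram} {r : ℕ} (h : Addable μ r) :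
    (addBox μ r).cells = insert (r, μ.rowLen r) μ.cells := by
  unfold addBox; rw [dif_pos h]

lemma notMem_corner (μ : YoungDiagram) (r : ℕ) : (r, μ.rowLen r) ∉ μ.cells := by
  rw [YoungDiagram.mem_cells, YoungDiagram.mem_iff_lt_rowLen]; omega

lemma card_addBox {μ : YoungDiagram} {r : ℕ} (h : Addable μ r) :
    (addBox μ r).card = μ.card + 1 := by
  rw [YoungDiagram.card, cells_addBox h, Finset.card_insert_of_notMem (notMem_corner μ r)]

lemma le_addBox {μ : YoungDiagram} {r : ℕ} (h : Addable μ r) : μ ≤ addBox μ r := by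
  intro c hc
  show c ∈ (addBox μ r).cells
  rw [cells_addBox h]
  exact Finset.mem_insert_of_mem hc

lemma covers_addBox {μ : YoungDiagram} {r : ℕ} (h : Addable μ r) : Covers μ (addBox μ r) :=
  ⟨le_addBox h, card_addBox h⟩

lemma rowLen_addBox {μ : YoungDiagram} {r : ℕ} (h : Addable μ r) (i : ℕ) :
    (addBox μ r).rowLen i = μ.rowLen i + if i = r then 1 else 0 := by
  have key : ∀ j, j < (addBox μ r).rowLen i ↔ j < μ.rowLen i + if i = r then 1 else 0 := by
    intro j
    rw [← YoungDiagram.mem_iff_lt_rowLen, ← YoungDiagram.mem_cells, cells_addBox h,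
      Finset.mem_insert, YoungDiagram.mem_cells, YoungDiagram.mem_iff_lt_rowLen, Prod.mk.injEq]
    split_ifs with h1
    · subst h1; omega
    · simp [h1]
  have k1 := key ((addBox μ r).rowLen i)
  have k2 := key (μ.rowLen i + if i = r then 1 else 0)
  omega

lemma stepRow_addBox {μ : YoungDiagram} {r : ℕ} (h : Addable μ r) :
    stepRow μ (addBox μ r) = r := by
  unfold stepRow
  rw [cells_addBox h, Finset.insert_sdiff_of_notMem _ (notMem_corner μ r)]
  simp

lemma covers_iff {μ τ : YoungDiagram} : Covers μ τ ↔ ∃ r, Addable μ r ∧ τ = addBox μ r := by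
  constructor
  · rintro ⟨hle, hc⟩
    have hsub : μ.cells ⊆ τ.cells := hle
    have h1 : (τ.cells \ μ.cells).card = 1 := by
      rw [Finset.card_sdiff_of_subset hsub]
      simp only [YoungDiagram.card] at hc; omega
    obtain ⟨⟨r, j⟩, hrj⟩ := Finset.card_eq_one.1 h1
    have hmem : ∀ c, c ∈ τ.cells ↔ c ∈ μ.cells ∨ c = (r, j) := by
      intro c
      have : c ∈ τ.cells \ μ.cells ↔ c = (r, j) := by rw [hrj, Finset.mem_singleton]
      rw [Finset.mem_sdiff] at this
      constructor
      · intro h; by_cases h' : c ∈ μ.cells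
        · exact Or.inl h'
        · exact Or.inr (this.1 ⟨h, h'⟩)
      · rintro (h | h)
        · exact hsub h
        · exact (this.2 h).1
    have hrjτ : (r, j) ∈ τ := by rw [← YoungDiagram.mem_cells, hmem]; simp
    have hrjμ : (r, j) ∉ μ := by
      have : (r, j) ∈ τ.cells \ μ.cells := by rw [hrj]; simp
      rw [Finset.mem_sdiff] at this; exact this.2
    have hj : j = μ.rowLen r := by
      rw [YoungDiagram.mem_iff_lt_rowLen] at hrjμ
      by_contra hne
      have h2 : (r, μ.rowLen r) ∈ τ := by
        rw [YoungDiagram.mem_iff_lt_rowLen] at hrjτ ⊢; omega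
      rw [← YoungDiagram.mem_cells, hmem] at h2
      rcases h2 with h2 | h2
      · exact notMem_corner _ _ h2
      · simp at h2; omega
    have hadd : Addable μ r := by
      by_contra hna
      unfold Addable at hna
      push Not at hna
      have h2 : (r - 1, j) ∈ τ := by
        apply τ.up_left_mem (i1 := r - 1) (i2 := r) (j1 := j) (j2 := j) (by omega) le_rfl hrjτ
      rw [← YoungDiagram.mem_cells, hmem] at h2
      rcases h2 with h2 | h2
      · rw [YoungDiagram.mem_cells, YoungDiagram.mem_iff_lt_rowLen] at h2; omega
      · simp at h2; omega
    refine ⟨r, hadd, ?_⟩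
    ext c
    rw [hmem, cells_addBox hadd, Finset.mem_insert, hj, or_comm]
  · rintro ⟨r, h, rfl⟩; exact covers_addBox h

lemma covers_stepRow_iff {μ τ : YoungDiagram} {r : ℕ} :
    (Covers μ τ ∧ stepRow μ τ = r) ↔ Addable μ r ∧ τ = addBox μ r := by
  constructor
  · rintro ⟨h, h2⟩
    obtain ⟨r', h', rfl⟩ := covers_iff.1 h
    rw [stepRow_addBox h'] at h2
    subst h2; exact ⟨h', rfl⟩
  · rintro ⟨h, rfl⟩
    exact ⟨covers_addBox h, stepRow_addBox h⟩

lemma colLen_addBox {μ : YoungDiagram} {r n : ℕ} (h : Addable μ r) (hr : r < n)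
    (hμ : μ.colLen 0 ≤ n) : (addBox μ r).colLen 0 ≤ n := by
  apply colLen_le_of
  rw [rowLen_addBox h, rowLen_eq_zero_of hμ le_rfl, if_neg (by omega)]

lemma finite_le (ν : YoungDiagram) : {ρ : YoungDiagram | ρ ≤ ν}.Finite := by
  apply Set.Finite.of_finite_image (f := YoungDiagram.cells)
  · apply Set.Finite.subset (Finset.finite_toSet ν.cells.powerset)
    rintro _ ⟨ρ, hρ, rfl⟩
    simp only [Finset.coe_powerset, Set.mem_preimage, Set.mem_powerset_iff, Finset.coe_subset]
    exact hρ
  · intro a _ b _ h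
    exact YoungDiagram.ext h

noncomputable def below (ν : YoungDiagram) : Finset YoungDiagram := (finite_le ν).toFinset

lemma mem_below {ρ ν : YoungDiagram} : ρ ∈ below ν ↔ ρ ≤ ν := by simp [below]

lemma card_le_of_le {μ ν : YoungDiagram} (h : μ ≤ ν) : μ.card ≤ ν.card :=
  Finset.card_le_card h

lemma eq_of_le_card {μ ν : YoungDiagram} (h : μ ≤ ν) (hc : ν.card ≤ μ.card) : μ = ν :=
  YoungDiagram.ext (Finset.eq_of_subset_of_card_le h hc)

end FactorialLR

namespace FactorialLR
open MvPolynomial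

section alt
variable {n : ℕ}

noncomputable def AE (x : Fin n → ℚ) (P : MvPolynomial (Fin n) ℚ) : ℚ :=
  ∑ σ : Equiv.Perm (Fin n), ((Equiv.Perm.sign σ : ℤ) : ℚ) * eval (fun i => x (σ i)) P

lemma AE_add (x : Fin n → ℚ) (P Q : MvPolynomial (Fin n) ℚ) : AE x (P + Q) = AE x P + AE x Q := by
  simp only [AE, map_add, mul_add, Finset.sum_add_distrib]

lemma AE_C_mul (x : Fin n → ℚ) (c : ℚ) (P : MvPolynomial (Fin n) ℚ) :
    AE x (C c * P) = c * AE x P := by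
  simp only [AE, map_mul, eval_C, Finset.mul_sum]
  exact Finset.sum_congr rfl fun σ _ => by ring

lemma AE_sum {ι : Type*} (x : Fin n → ℚ) (s : Finset ι) (P : ι → MvPolynomial (Fin n) ℚ) :
    AE x (∑ i ∈ s, P i) = ∑ i ∈ s, AE x (P i) := by
  simp only [AE, map_sum, Finset.mul_sum]
  rw [Finset.sum_comm]

lemma AE_sr (x : Fin n → ℚ) {p q : Fin n} (hpq : p ≠ q) (P : MvPolynomial (Fin n) ℚ) :
    AE x (sr p q P) = - AE x P := by
  unfold AE
  rw [← Finset.sum_neg_distrib]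
  refine Fintype.sum_equiv (Equiv.mulRight (Equiv.swap p q)) _ _ fun σ => ?_
  simp only [Equiv.coe_mulRight, Equiv.Perm.sign_mul, Equiv.Perm.sign_swap hpq, sr, eval_rename]
  simp [Function.comp_def]

lemma AE_eq_zero (x : Fin n → ℚ) {p q : Fin n} (hpq : p ≠ q) {P : MvPolynomial (Fin n) ℚ}
    (h : sr p q P = P) : AE x P = 0 := by
  have := AE_sr x hpq P
  rw [h] at this; linarith

lemma eval_perm {Q : MvPolynomial (Fin n) ℚ}
    (hQ : ∀ p q : Fin n, (p : ℕ) + 1 = q → sr p q Q = Q) (σ : Equiv.Perm (Fin n))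
    (x : Fin n → ℚ) : eval (fun i => x (σ i)) Q = eval x Q := by
  cases n with
  | zero => congr 1; congr 1; funext i; exact i.elim0
  | succ m =>
    have hσ : σ ∈ Submonoid.closure
        (Set.range fun i : Fin m ↦ Equiv.swap i.castSucc i.succ) := by
      rw [Equiv.Perm.mclosure_swap_castSucc_succ]; trivial
    induction hσ using Submonoid.closure_induction generalizing x with
    | mem σ hσ =>
      obtain ⟨i, rfl⟩ := hσ
      have := hQ i.castSucc i.succ (by simp)
      conv_rhs => rw [← this]
      simp only [sr, eval_rename]
      rfl
    | one => rfl
    | mul a b _ _ ha hb =>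
      have := hb (fun i => x (a i))
      rw [ha] at this
      exact this

lemma AE_sym_mul {Q : MvPolynomial (Fin n) ℚ}
    (hQ : ∀ p q : Fin n, (p : ℕ) + 1 = q → sr p q Q = Q) (x : Fin n → ℚ)
    (P : MvPolynomial (Fin n) ℚ) : AE x (Q * P) = eval x Q * AE x P := by
  unfold AE
  rw [Finset.mul_sum]
  refine Finset.sum_congr rfl fun σ _ => ?_
  rw [map_mul, eval_perm hQ]; ring

noncomputable def mon (k : Fin n → ℕ) : MvPolynomial (Fin n) ℚ :=
  ∏ i, ∏ t ∈ Finset.range (k i), (X i - C (t : ℚ))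

def kv (n : ℕ) (μ : YoungDiagram) : Fin n → ℕ := fun i => μ.rowLen i + (n - 1 - i)

def bump (k : Fin n → ℕ) (r : Fin n) : Fin n → ℕ := fun i => k i + if i = r then 1 else 0

lemma mon_bump (k : Fin n → ℕ) (r : Fin n) : mon (bump k r) = (X r - C (k r : ℚ)) * mon k := by
  unfold mon
  rw [← Finset.mul_prod_erase _ _ (Finset.mem_univ r),
    ← Finset.mul_prod_erase Finset.univ _ (Finset.mem_univ r)]
  have : ∀ i ∈ Finset.univ.erase r, (∏ t ∈ Finset.range (bump k r i), (X i - C (t : ℚ))) =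
      ∏ t ∈ Finset.range (k i), (X i - C (t : ℚ) : MvPolynomial (Fin n) ℚ) := by
    intro i hi
    simp only [Finset.mem_erase] at hi
    simp [bump, hi.1]
  rw [Finset.prod_congr rfl this]
  simp only [bump, if_true, Finset.prod_range_succ]
  ring

lemma sr_mon {k : Fin n → ℕ} {p q : Fin n} (h : k p = k q) : sr p q (mon k) = mon k := by
  unfold mon
  rw [map_prod]
  refine Fintype.prod_equiv (Equiv.swap p q) _ _ fun i => ?_
  rw [map_prod]
  have : k (Equiv.swap p q i) = k i := by
    by_cases h1 : i = p
    · subst h1; simp [h]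
    by_cases h2 : i = q
    · subst h2; simp [h]
    rw [Equiv.swap_apply_of_ne_of_ne h1 h2]
  rw [this]
  refine Finset.prod_congr rfl fun t _ => ?_
  rw [map_sub, sr_X, sr_C]

lemma kv_addBox {μ : YoungDiagram} {r : Fin n} (h : Addable μ r) :
    kv n (addBox μ r) = bump (kv n μ) r := by
  funext i
  simp only [kv, bump, rowLen_addBox h, Fin.ext_iff]; omega

lemma not_addable {μ : YoungDiagram} {r : Fin n} (h : ¬ Addable μ r) :
    ∃ p : Fin n, (p : ℕ) + 1 = r ∧ bump (kv n μ) r p = bump (kv n μ) r r := by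
  unfold Addable at h
  push Not at h
  have h1 := μ.rowLen_anti (r - 1) r (by omega)
  have hr := r.2
  refine ⟨⟨r - 1, by omega⟩, by simp; omega, ?_⟩
  simp only [bump, kv, Fin.ext_iff, if_true]
  rw [if_neg (by omega)]
  omega

/-- The truncated process. -/
def proc : List (Fin n × ℚ) → (YoungDiagram → ℚ) → YoungDiagram → ℚ
  | [], c, μ => c μ
  | (r, b) :: l, c, μ => ((kv n μ r : ℚ) - b) * proc l c μ +
      if Addable μ r then proc l c (addBox μ r) else 0

lemma proc_append (l l' : List (Fin n × ℚ)) (c : YoungDiagram → ℚ) (μ : YoungDiagram) :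
    proc (l ++ l') c μ = proc l (proc l' c) μ := by
  induction l generalizing μ with
  | nil => rfl
  | cons a l ih => obtain ⟨r, b⟩ := a; simp only [List.cons_append, proc, ih]

lemma proc_sum {ι : Type*} (s : Finset ι) (l : List (Fin n × ℚ)) (w : ι → ℚ)
    (c : ι → YoungDiagram → ℚ)
    (μ : YoungDiagram) :
    proc l (fun κ => ∑ i ∈ s, w i * c i κ) μ = ∑ i ∈ s, w i * proc l (c i) μ := by
  induction l generalizing μ with
  | nil => rfl
  | cons a l ih =>
    obtain ⟨r, b⟩ := a
    simp only [proc, ih]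
    split_ifs
    · rw [Finset.mul_sum, ← Finset.sum_add_distrib]
      exact Finset.sum_congr rfl fun i _ => by ring
    · rw [Finset.mul_sum, add_zero]
      exact Finset.sum_congr rfl fun i _ => by ring

lemma proc_congr (l : List (Fin n × ℚ)) {c c' : YoungDiagram → ℚ}
    (h : ∀ κ : YoungDiagram, κ.colLen 0 ≤ n → c κ = c' κ) {μ : YoungDiagram}
    (hμ : μ.colLen 0 ≤ n) : proc l c μ = proc l c' μ := by
  induction l generalizing μ with
  | nil => exact h μ hμ
  | cons a l ih =>
    obtain ⟨r, b⟩ := a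
    simp only [proc]
    rw [ih hμ]
    split_ifs with hA
    · rw [ih (colLen_addBox hA r.2 hμ)]
    · rfl

lemma proc_alt (x : Fin n → ℚ) (l : List (Fin n × ℚ)) (hl : l.Pairwise (fun a b => a.1 < b.1))
    (Q : MvPolynomial (Fin n) ℚ)
    (hQ : ∀ a ∈ l, ∀ p : Fin n, (p : ℕ) + 1 = (a.1 : ℕ) → sr p a.1 Q = Q) (μ : YoungDiagram) :
    proc l (fun κ => AE x (Q * mon (kv n κ))) μ =
      AE x ((l.map fun a => X a.1 - C a.2).prod * Q * mon (kv n μ)) := by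
  induction l generalizing μ with
  | nil => simp [proc]
  | cons a l ih =>
    obtain ⟨r, b⟩ := a
    rw [List.pairwise_cons] at hl
    have ih := ih hl.2 (fun a ha => hQ a (List.mem_cons_of_mem _ ha))
    simp only [proc, ih]
    have e : ((List.map (fun a : Fin n × ℚ => (X a.1 - C a.2 : MvPolynomial (Fin n) ℚ))
          ((r, b) :: l)).prod * Q *
        mon (kv n μ)) = C ((kv n μ r : ℚ) - b) *
          ((l.map fun a => X a.1 - C a.2).prod * Q * mon (kv n μ)) +
          (l.map fun a => X a.1 - C a.2).prod * Q * mon (bump (kv n μ) r) := by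
      rw [mon_bump, List.map_cons, List.prod_cons, map_sub]
      ring
    rw [e, AE_add, AE_C_mul]
    congr 1
    split_ifs with hA
    · rw [kv_addBox hA]
    · symm
      obtain ⟨p, hp, hk⟩ := not_addable hA
      have hne : p ≠ r := fun h => by subst h; omega
      apply AE_eq_zero x hne
      rw [map_mul, map_mul, sr_mon hk, hQ (r, b) (by simp) p hp]
      congr 2
      rw [map_list_prod, List.map_map]
      congr 1
      apply List.map_congr_left
      intro a ha
      have h1 : (r : ℕ) < a.1 := hl.1 a ha
      simp only [Function.comp_apply, map_sub, sr_X, sr_C]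
      rw [Equiv.swap_apply_of_ne_of_ne]
      · intro h; rw [Fin.ext_iff] at h; omega
      · intro h; rw [Fin.ext_iff] at h; omega

def colList (j : ℕ) (δ : Finset (Fin n)) : List (Fin n × ℚ) :=
  (δ.sort (· ≤ ·)).map fun v => (v, bw j δ v)

def V (h : ℕ → ℕ) (c : YoungDiagram → ℚ) : ℕ → Finset (Fin n) → YoungDiagram → ℚ
  | 0, _ => c
  | j + 1, γ => fun μ =>
    ∑ δ ∈ Finset.univ.filter (fun δ : Finset (Fin n) => δ.card = h j ∧ Dom δ γ),
      proc (colList j δ) (V h c j δ) μ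

lemma V_sum {ι : Type*} (s : Finset ι) (h : ℕ → ℕ) (w : ι → ℚ) (c : ι → YoungDiagram → ℚ)
    (j : ℕ) (γ : Finset (Fin n)) (μ : YoungDiagram) :
    V h (fun κ => ∑ i ∈ s, w i * c i κ) j γ μ = ∑ i ∈ s, w i * V h (c i) j γ μ := by
  induction j generalizing γ μ with
  | zero => rfl
  | succ j ih =>
    simp only [V, Finset.mul_sum]
    rw [Finset.sum_comm]
    refine Finset.sum_congr rfl fun δ _ => ?_
    rw [← proc_sum]
    congr 1
    funext κ
    exact ih δ κ

lemma colList_prod (j : ℕ) (δ : Finset (Fin n)) :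
    ((colList j δ).map fun a => (X a.1 - C a.2 : MvPolynomial (Fin n) ℚ)).prod = colW j δ := by
  unfold colList colW
  rw [List.map_map, ← Finset.prod_map_toList]
  apply List.Perm.prod_eq
  apply List.Perm.map
  exact (Finset.sort_perm_toList _ _)

theorem V_alt (x : Fin n → ℚ) (h : ℕ → ℕ) (c : YoungDiagram → ℚ)
    (hc : ∀ κ : YoungDiagram, κ.colLen 0 ≤ n → c κ = AE x (mon (kv n κ)))
    (j : ℕ) (γ : Finset (Fin n)) {μ : YoungDiagram} (hμ : μ.colLen 0 ≤ n) :
    V h c j γ μ = AE x (Z h j γ * mon (kv n μ)) := by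
  induction j generalizing γ μ with
  | zero => simp [V, Z, hc μ hμ]
  | succ j ih =>
    simp only [V, Z, Finset.sum_mul, AE_sum]
    refine Finset.sum_congr rfl fun δ _ => ?_
    rw [proc_congr (colList j δ) (fun κ hκ => ih δ hκ) hμ, proc_alt, colList_prod]
    · unfold colList
      rw [List.pairwise_map]
      exact (Finset.sortedLT_sort δ).pairwise
    · intro a ha p hp
      apply (symStmt hp h j).1
      intro _
      unfold colList at ha
      rw [List.mem_map] at ha
      obtain ⟨v, hv, rfl⟩ := ha
      simpa using hv

lemma Z_sym (h : ℕ → ℕ) (j : ℕ) (p q : Fin n) (hpq : (p : ℕ) + 1 = q) :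
    sr p q (Z h j (∅ : Finset (Fin n))) = Z h j ∅ :=
  (symStmt hpq h j).1 ∅ (by simp)

end alt
end FactorialLR

namespace FactorialLR
open MvPolynomial

section aval
variable {n : ℕ}

noncomputable def aval (n : ℕ) (μ ρ : YoungDiagram) : ℚ :=
  AE (fun i : Fin n => (kv n ρ i : ℚ)) (mon (kv n μ))

lemma kv_anti (μ : YoungDiagram) {i j : Fin n} (h : i < j) : kv n μ j < kv n μ i := by
  unfold kv
  have := μ.rowLen_anti i j (le_of_lt h)
  have h1 : (i : ℕ) < j := h
  have h2 := j.2
  omega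

lemma kv_anti' (μ : YoungDiagram) {i j : Fin n} (h : i ≤ j) : kv n μ j ≤ kv n μ i := by
  rcases h.eq_or_lt with rfl | h
  · exact le_rfl
  · exact (kv_anti μ h).le

lemma eval_mon (x k : Fin n → ℕ) :
    eval (fun i => (x i : ℚ)) (mon k) = ∏ i, ∏ t ∈ Finset.range (k i), ((x i : ℚ) - t) := by
  simp [mon, map_prod]

lemma eval_mon_ne {x k : Fin n → ℕ} : eval (fun i => (x i : ℚ)) (mon k) ≠ 0 ↔ ∀ i, k i ≤ x i := by
  rw [eval_mon, Finset.prod_ne_zero_iff]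
  constructor
  · intro h i
    have h1 := h i (Finset.mem_univ i)
    rw [Finset.prod_ne_zero_iff] at h1
    by_contra hc
    exact h1 (x i) (Finset.mem_range.2 (by omega)) (by simp)
  · intro h i _
    rw [Finset.prod_ne_zero_iff]
    intro t ht
    rw [Finset.mem_range] at ht
    have h2 := h i
    rw [sub_ne_zero]
    exact_mod_cast (by omega : x i ≠ t)

lemma exists_ge (σ : Equiv.Perm (Fin n)) (i : Fin n) : ∃ j ≤ i, i ≤ σ j := by
  by_contra hc
  push Not at hc
  have h1 : (Finset.Iic i).card ≤ (Finset.Iio i).card := by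
    apply Finset.card_le_card_of_injOn σ
    · intro j hj
      simp only [Finset.coe_Iic, Set.mem_Iic, Finset.coe_Iio, Set.mem_Iio] at hj ⊢
      exact hc j hj
    · exact σ.injective.injOn
  simp at h1

lemma le_of_kv {μ ρ : YoungDiagram} (hμ : μ.colLen 0 ≤ n) (h : ∀ i, kv n μ i ≤ kv n ρ i) :
    μ ≤ ρ := by
  rw [yd_le_iff]
  intro i
  by_cases hi : i < n
  · have := h ⟨i, hi⟩
    simp only [kv] at this; omega
  · rw [rowLen_eq_zero_of hμ (by omega)]; omega

lemma aval_zero {μ ρ : YoungDiagram} (hμ : μ.colLen 0 ≤ n) (h : ¬ μ ≤ ρ) : aval n μ ρ = 0 := by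
  unfold aval AE
  apply Finset.sum_eq_zero
  intro σ _
  by_contra hne
  have h1 := (eval_mon_ne (x := fun i => kv n ρ (σ i)) (k := kv n μ)).1 (right_ne_zero_of_mul hne)
  apply h
  apply le_of_kv hμ
  intro i
  obtain ⟨j, hj, hj2⟩ := exists_ge σ i
  exact (kv_anti' μ hj).trans ((h1 j).trans (kv_anti' ρ hj2))

lemma aval_self (ρ : YoungDiagram) : aval n ρ ρ ≠ 0 := by
  unfold aval AE
  rw [Finset.sum_eq_single 1]
  · simp only [Equiv.Perm.sign_one, Units.val_one, Int.cast_one, one_mul]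
    exact (eval_mon_ne (x := fun i => kv n ρ i) (k := kv n ρ)).2 fun i => le_rfl
  · intro σ _ hσ
    by_contra hne
    have h1 := (eval_mon_ne (x := fun i => kv n ρ (σ i)) (k := kv n ρ)).1
      (right_ne_zero_of_mul hne)
    apply hσ
    have h2 : ∀ i, σ i ≤ i := by
      intro i
      by_contra hc
      push Not at hc
      have := kv_anti ρ hc
      have := h1 i
      omega
    have h3 : ∀ m : ℕ, ∀ i : Fin n, (i : ℕ) = m → σ i = i := by
      intro m
      induction m using Nat.strong_induction_on with
      | _ m ih =>
        intro i hi
        rcases (h2 i).eq_or_lt with h | h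
        · exact h
        · have := ih (σ i) (by rw [← hi]; exact h) (σ i) rfl
          exact absurd (σ.injective this) (ne_of_lt h)
    ext i
    rw [h3 _ i rfl]; rfl
  · simp

lemma sum_kv {μ : YoungDiagram} (hμ : μ.colLen 0 ≤ n) :
    (∑ i : Fin n, (kv n μ i : ℚ)) = μ.card + ∑ i : Fin n, ((n - 1 - i : ℕ) : ℚ) := by
  rw [card_eq_sum hμ, ← Fin.sum_univ_eq_sum_range (fun i => μ.rowLen i)]
  push_cast [kv]
  rw [Finset.sum_add_distrib]

lemma sr_sumX (p q : Fin n) : sr p q (∑ i, X i) = ∑ i, X i := by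
  rw [map_sum]
  exact Fintype.sum_equiv (Equiv.swap p q) _ _ fun i => sr_X i

lemma aval_pieri {μ ρ : YoungDiagram} (hμ : μ.colLen 0 ≤ n) (hρ : ρ.colLen 0 ≤ n) :
    ((ρ.card : ℚ) - μ.card) * aval n μ ρ =
      ∑ r : Fin n, if Addable μ r then aval n (addBox μ r) ρ else 0 := by
  have h1 := AE_sym_mul (Q := ∑ i : Fin n, X i) (fun p q _ => sr_sumX p q)
    (fun i : Fin n => (kv n ρ i : ℚ)) (mon (kv n μ))
  have h2 : (∑ i : Fin n, X i) * mon (kv n μ) =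
      ∑ r : Fin n, (mon (bump (kv n μ) r) + C (kv n μ r : ℚ) * mon (kv n μ)) := by
    rw [Finset.sum_mul]
    refine Finset.sum_congr rfl fun r _ => ?_
    rw [mon_bump]; ring
  rw [h2, AE_sum] at h1
  simp only [AE_add, AE_C_mul, Finset.sum_add_distrib, ← Finset.sum_mul, map_sum, eval_X] at h1
  rw [sum_kv hμ, sum_kv hρ] at h1
  have h3 : (∑ r : Fin n, if Addable μ r then aval n (addBox μ r) ρ else 0) =
      ∑ r : Fin n, AE (fun i : Fin n => (kv n ρ i : ℚ)) (mon (bump (kv n μ) r)) := by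
    refine Finset.sum_congr rfl fun r _ => ?_
    split_ifs with hA
    · rw [aval, kv_addBox hA]
    · symm
      obtain ⟨p, hp, hk⟩ := not_addable hA
      have hne : p ≠ r := fun h => by subst h; omega
      exact AE_eq_zero _ hne (sr_mon hk)
  rw [h3, aval]
  linarith

open Classical in
lemma sum_covers {μ ρ : YoungDiagram} (hρ : ρ.colLen 0 ≤ n) (F : YoungDiagram → ℚ)
    (hμ : μ.colLen 0 ≤ n)
    (hF : ∀ τ : YoungDiagram, τ.colLen 0 ≤ n → ¬ τ ≤ ρ → F τ = 0) :
    (∑ r : Fin n, if Addable μ r then F (addBox μ r) else 0) =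
      ∑ τ ∈ (below ρ).filter (Covers μ), F τ := by
  rw [← Finset.sum_filter]
  have : ∑ r ∈ Finset.univ.filter (fun r : Fin n => Addable μ r), F (addBox μ r) =
      ∑ r ∈ Finset.univ.filter (fun r : Fin n => Addable μ r ∧ addBox μ r ≤ ρ),
        F (addBox μ r) := by
    symm
    apply Finset.sum_subset
    · intro r; simp only [Finset.mem_filter]; tauto
    · intro r hr hr2
      simp only [Finset.mem_filter, Finset.mem_univ, true_and, not_and] at hr hr2
      exact hF _ (colLen_addBox hr r.2 hμ) (hr2 hr)
  rw [this]
  apply Finset.sum_bij (fun (r : Fin n) _ => addBox μ r)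
  · intro r hr
    simp only [Finset.mem_filter, Finset.mem_univ, true_and] at hr
    simp only [Finset.mem_filter, mem_below]
    exact ⟨hr.2, covers_addBox hr.1⟩
  · intro r hr r' hr' heq
    simp only [Finset.mem_filter, Finset.mem_univ, true_and] at hr hr'
    have := stepRow_addBox hr.1
    rw [heq, stepRow_addBox hr'.1] at this
    exact Fin.ext this.symm
  · intro τ hτ
    simp only [Finset.mem_filter, mem_below] at hτ
    obtain ⟨r, hA, rfl⟩ := covers_iff.1 hτ.2
    have hrn : r < n := by
      by_contra hc
      have h1 := yd_le_iff.1 hτ.1 r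
      rw [rowLen_addBox hA, rowLen_eq_zero_of hρ (by omega)] at h1
      simp at h1
    refine ⟨⟨r, hrn⟩, ?_, rfl⟩
    simp only [Finset.mem_filter, Finset.mem_univ, true_and]
    exact ⟨hA, hτ.1⟩
  · intros; rfl

end aval

/-- `1/h` -/
noncomputable def gg (μ ν : YoungDiagram) : ℚ :=
  open Classical in if μ ≤ ν then (dimSkew μ ν : ℚ) / (Nat.factorial (ν.card - μ.card) : ℚ) else 0

lemma gg_of_le {μ ν : YoungDiagram} (h : μ ≤ ν) : gg μ ν = (hk μ ν)⁻¹ := by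
  unfold gg hk
  rw [if_pos h, inv_div]

lemma gg_of_not {μ ν : YoungDiagram} (h : ¬ μ ≤ ν) : gg μ ν = 0 := by
  unfold gg; rw [if_neg h]

/-- standard fillings -/
def Std (s : Finset (ℕ × ℕ)) (m : ℕ) : Set (s → Fin m) := {T |
    Function.Bijective T ∧
    (∀ c c' : s,
      (c : ℕ × ℕ).1 = (c' : ℕ × ℕ).1 → (c : ℕ × ℕ).2 < (c' : ℕ × ℕ).2 → T c < T c') ∧
    (∀ c c' : s,
      (c : ℕ × ℕ).1 < (c' : ℕ × ℕ).1 → (c : ℕ × ℕ).2 = (c' : ℕ × ℕ).2 → T c < T c')}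

lemma dimSkew_eq (μ ν : YoungDiagram) {m : ℕ} (h : ν.card - μ.card = m) :
    dimSkew μ ν = Nat.card (Std (skewCells μ ν) m) := by
  subst h; rfl

lemma dimSkew_self (μ : YoungDiagram) : dimSkew μ μ = 1 := by
  rw [dimSkew_eq μ μ (m := 0) (by omega)]
  have hs : skewCells μ μ = ∅ := by simp [skewCells]
  rw [hs, Nat.card_eq_one_iff_unique]
  refine ⟨⟨fun a b => Subtype.ext (funext fun c => absurd c.2 (Finset.notMem_empty _))⟩,
    ⟨⟨fun c => absurd c.2 (Finset.notMem_empty _), ?_, ?_, ?_⟩⟩⟩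
  · refine ⟨fun c => absurd c.2 (Finset.notMem_empty _), fun i => i.elim0⟩
  · intro c; exact absurd c.2 (Finset.notMem_empty _)
  · intro c; exact absurd c.2 (Finset.notMem_empty _)

/-- fillings with smallest entry at `c` versus fillings of the rest -/
lemma card_std_erase (s : Finset (ℕ × ℕ)) (m : ℕ) (c : s)
    (hmin : ∀ c' : s, ((c' : ℕ × ℕ).1 = (c : ℕ × ℕ).1 → ¬ (c' : ℕ × ℕ).2 < (c : ℕ × ℕ).2) ∧
      ((c' : ℕ × ℕ).2 = (c : ℕ × ℕ).2 → ¬ (c' : ℕ × ℕ).1 < (c : ℕ × ℕ).1)) :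
    Nat.card {T : Std s (m + 1) // T.1 c = 0} = Nat.card (Std (s.erase c) m) := by
  have hmem : ∀ d : s.erase (c : ℕ × ℕ), (d : ℕ × ℕ) ∈ s := fun d => Finset.mem_of_mem_erase d.2
  have hne : ∀ d : s.erase (c : ℕ × ℕ), (⟨d, hmem d⟩ : s) ≠ c := fun d h =>
    Finset.ne_of_mem_erase d.2 (congrArg Subtype.val h)
  apply Nat.card_congr
  refine
    { toFun := fun T => ⟨fun d => (T.1.1 ⟨d, hmem d⟩).pred (fun h => hne d (T.1.2.1.1
        (h.trans T.2.symm))), ?_, ?_, ?_⟩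
      invFun := fun T => ⟨⟨fun d => if h : d = c then 0 else
        (T.1 ⟨d, Finset.mem_erase.2 ⟨fun h' => h (Subtype.ext h'), d.2⟩⟩).succ, ?_, ?_, ?_⟩, ?_⟩
      left_inv := ?_
      right_inv := ?_ }
  · constructor
    · intro d d' h
      have h1 := T.1.2.1.1 (Fin.pred_inj.1 h)
      exact Subtype.ext (congrArg (fun z : s => (z : ℕ × ℕ)) h1)
    · intro i
      obtain ⟨d, hd⟩ := T.1.2.1.2 i.succ
      have hdc : d ≠ c := by
        rintro rfl
        rw [T.2] at hd
        exact Fin.succ_ne_zero i hd.symm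
      refine ⟨⟨d, Finset.mem_erase.2 ⟨fun h' => hdc (Subtype.ext h'), d.2⟩⟩, ?_⟩
      simp only [Subtype.coe_eta, hd, Fin.pred_succ]
  · intro d d' h1 h2
    exact Fin.pred_lt_pred_iff.2 (T.1.2.2.1 _ _ h1 h2)
  · intro d d' h1 h2
    exact Fin.pred_lt_pred_iff.2 (T.1.2.2.2 _ _ h1 h2)
  · constructor
    · intro d d' h
      by_cases e : d = c <;> by_cases e' : d' = c
      · rw [e, e']
      · simp only [e, e', dif_pos, dif_neg, not_false_eq_true] at h
        exact absurd h.symm (Fin.succ_ne_zero _)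
      · simp only [e, e', dif_pos, dif_neg, not_false_eq_true] at h
        exact absurd h (Fin.succ_ne_zero _)
      · simp only [e, e', dif_neg, not_false_eq_true] at h
        have := T.2.1.1 (Fin.succ_injective _ h)
        exact Subtype.ext (congrArg (fun z : s.erase (c : ℕ × ℕ) => (z : ℕ × ℕ)) this)
    · intro i
      refine Fin.cases ⟨c, by simp⟩ (fun i => ?_) i
      obtain ⟨d, hd⟩ := T.2.1.2 i
      refine ⟨⟨d, hmem d⟩, ?_⟩
      simp only [dif_neg (hne d), Subtype.coe_eta, hd]
  · intro d d' h1 h2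
    by_cases e : d = c
    · have e' : d' ≠ c := by rintro rfl; subst e; omega
      simp only [e, e', dif_pos, dif_neg, not_false_eq_true]
      exact Fin.succ_pos _
    · have e' : d' ≠ c := by
        rintro rfl; exact (hmin d).1 h1 h2
      simp only [e, e', dif_neg, not_false_eq_true]
      exact Fin.succ_lt_succ_iff.2 (T.2.2.1 _ _ h1 h2)
  · intro d d' h1 h2
    by_cases e : d = c
    · have e' : d' ≠ c := by rintro rfl; subst e; omega
      simp only [e, e', dif_pos, dif_neg, not_false_eq_true]
      exact Fin.succ_pos _
    · have e' : d' ≠ c := by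
        rintro rfl; exact (hmin d).2 h2 h1
      simp only [e, e', dif_neg, not_false_eq_true]
      exact Fin.succ_lt_succ_iff.2 (T.2.2.2 _ _ h1 h2)
  · simp
  · intro T
    apply Subtype.ext
    apply Subtype.ext
    funext d
    by_cases e : d = c
    · simp only [e, dif_pos]; exact T.2.symm
    · simp only [e, dif_neg, not_false_eq_true, Fin.succ_pred]
  · intro T
    apply Subtype.ext
    funext d
    simp only [dif_neg (hne d), Fin.pred_succ, Subtype.coe_eta]

lemma skewCells_addBox {μ ν : YoungDiagram} {r : ℕ} (h : Addable μ r) :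
    skewCells (addBox μ r) ν = (skewCells μ ν).erase (r, μ.rowLen r) := by
  unfold skewCells
  rw [cells_addBox h]
  ext c
  simp only [Finset.mem_sdiff, Finset.mem_insert, Finset.mem_erase]
  tauto

open Classical in
lemma dimSkew_rec {μ ν : YoungDiagram} {n : ℕ} (hν : ν.colLen 0 ≤ n) (hle : μ ≤ ν) (hne : μ ≠ ν) :
    dimSkew μ ν = ∑ r : Fin n, if Addable μ r ∧ addBox μ r ≤ ν then dimSkew (addBox μ r) ν
      else 0 := by
  have hcard : μ.card < ν.card := by
    by_contra hc
    exact hne (eq_of_le_card hle (by omega))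
  obtain ⟨m, hm⟩ : ∃ m, ν.card - μ.card = m + 1 := ⟨ν.card - μ.card - 1, by omega⟩
  rw [dimSkew_eq μ ν hm]
  set s := skewCells μ ν with hs
  -- the row of the cell carrying the smallest entry
  have hrow : ∀ T : Std s (m + 1), ∃ r : Fin n, ∃ hh : (Addable μ r ∧ addBox μ r ≤ ν),
      ∃ hc : ((r : ℕ), μ.rowLen r) ∈ s, T.1 ⟨_, hc⟩ = 0 := by
    intro T
    obtain ⟨⟨⟨r, j⟩, hc⟩, h0⟩ := T.2.1.2 0
    have hc' := hc
    rw [hs, skewCells, Finset.mem_sdiff] at hc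
    have hcν : (r, j) ∈ ν := hc.1
    have hcμ : (r, j) ∉ μ := hc.2
    have hj : j = μ.rowLen r := by
      rw [YoungDiagram.mem_iff_lt_rowLen] at hcμ
      by_contra hjne
      have h1 : (r, μ.rowLen r) ∈ s := by
        rw [hs, skewCells, Finset.mem_sdiff]
        refine ⟨?_, notMem_corner _ _⟩
        rw [YoungDiagram.mem_cells]
        exact ν.up_left_mem le_rfl (by omega) hcν
      have := T.2.2.1 ⟨_, h1⟩ ⟨_, hc'⟩ rfl (by simp; omega)
      rw [h0] at this
      exact absurd this (Fin.not_lt_zero _)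
    subst hj
    have hA : Addable μ r := by
      by_contra hna
      unfold Addable at hna
      push Not at hna
      have h1 : (r - 1, μ.rowLen r) ∈ s := by
        rw [hs, skewCells, Finset.mem_sdiff]
        constructor
        · rw [YoungDiagram.mem_cells]
          exact ν.up_left_mem (by omega) le_rfl hcν
        · rw [YoungDiagram.mem_cells, YoungDiagram.mem_iff_lt_rowLen]; omega
      have := T.2.2.2 ⟨_, h1⟩ ⟨_, hc'⟩ (by simp; omega) rfl
      rw [h0] at this
      exact absurd this (Fin.not_lt_zero _)
    have hrn : r < n := by
      by_contra hcon
      rw [YoungDiagram.mem_iff_lt_rowLen, rowLen_eq_zero_of hν (by omega)] at hcν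
      omega
    refine ⟨⟨r, hrn⟩, ⟨hA, ?_⟩, hc', h0⟩
    intro c hc
    have hc2 : c ∈ (addBox μ r).cells := hc
    rw [cells_addBox hA, Finset.mem_insert] at hc2
    rcases hc2 with rfl | hc2
    · exact hcν
    · exact hle hc2
  choose rr hr1 hr2 hr3 using hrow
  have hfin : Finite (Std s (m + 1)) := inferInstance
  have := Fintype.ofFinite (Std s (m + 1))
  rw [Nat.card_eq_fintype_card, ← Finset.card_univ,
    Finset.card_eq_sum_card_fiberwise (f := rr) (t := Finset.univ) (by simp)]
  refine Finset.sum_congr rfl fun r _ => ?_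
  split_ifs with hh
  · have hmemc : ((r : ℕ), μ.rowLen r) ∈ s := by
      rw [hs, skewCells, Finset.mem_sdiff]
      refine ⟨?_, notMem_corner _ _⟩
      apply hh.2
      show _ ∈ (addBox μ r).cells
      rw [cells_addBox hh.1]; simp
    rw [dimSkew_eq (addBox μ r) ν (m := m) (by rw [card_addBox hh.1]; omega),
      skewCells_addBox hh.1]
    rw [← card_std_erase s m ⟨_, hmemc⟩]
    · rw [← Fintype.card_coe, ← Nat.card_eq_fintype_card]
      apply Nat.card_congr
      apply Equiv.subtypeEquivRight
      intro T
      simp only [Finset.mem_filter, Finset.mem_univ, true_and]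
      constructor
      · rintro rfl; exact hr3 T
      · intro h0
        have := T.2.1.1 (h0.trans (hr3 T).symm)
        simp only [Subtype.mk.injEq, Prod.mk.injEq] at this
        exact Fin.ext this.1.symm
    · rintro ⟨⟨a, b⟩, hab⟩
      rw [hs, skewCells, Finset.mem_sdiff, YoungDiagram.mem_cells, YoungDiagram.mem_cells,
        YoungDiagram.mem_iff_lt_rowLen, YoungDiagram.mem_iff_lt_rowLen] at hab
      simp only
      refine ⟨by rintro rfl; omega, ?_⟩
      intro hb hlt
      have hA := hh.1
      unfold Addable at hA
      have := μ.rowLen_anti a (r - 1) (by omega)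
      omega
  · rw [Finset.card_eq_zero, Finset.filter_eq_empty_iff]
    rintro T _ rfl
    exact hh (hr1 T)

lemma gg_self (μ : YoungDiagram) : gg μ μ = 1 := by
  unfold gg; rw [if_pos le_rfl, dimSkew_self]; simp

open Classical in
lemma gg_rec {μ ν : YoungDiagram} :
    ((ν.card : ℚ) - μ.card) * gg μ ν = ∑ τ ∈ (below ν).filter (Covers μ), gg τ ν := by
  set n := ν.colLen 0 with hn
  have hν : ν.colLen 0 ≤ n := le_rfl
  by_cases hle : μ ≤ ν
  · have hμ := colLen_mono hle hν
    rcases eq_or_ne μ ν with rfl | hne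
    · rw [sub_self, zero_mul]
      symm
      apply Finset.sum_eq_zero
      intro τ hτ
      simp only [Finset.mem_filter, mem_below] at hτ
      have h1 := card_le_of_le hτ.1
      have h2 := hτ.2.2
      omega
    · rw [← sum_covers hν (fun τ => gg τ ν) hμ (fun τ _ h => gg_of_not h)]
      have hcard : μ.card < ν.card := by
        by_contra hc
        exact hne (eq_of_le_card hle (by omega))
      obtain ⟨m, hm⟩ : ∃ m, ν.card = μ.card + (m + 1) := ⟨ν.card - μ.card - 1, by omega⟩
      unfold gg
      rw [if_pos hle, dimSkew_rec hν hle hne]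
      have e : ν.card - μ.card = m + 1 := by omega
      rw [e, hm, Nat.factorial_succ]
      push_cast
      have hf : (Nat.factorial m : ℚ) ≠ 0 := by exact_mod_cast Nat.factorial_ne_zero m
      have hm1 : (m : ℚ) + 1 ≠ 0 := by positivity
      have e3 : ((μ.card : ℚ) + (m + 1) - μ.card) = m + 1 := by ring
      rw [e3, mul_div_assoc', mul_comm ((m : ℚ) + 1) (Finset.sum _ _),
        mul_comm ((m : ℚ) + 1) (Nat.factorial m : ℚ), mul_div_mul_right _ _ hm1, Finset.sum_div]
      refine Finset.sum_congr rfl fun r _ => ?_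
      by_cases hA : Addable μ r
      · have e2 : ν.card - (addBox μ r).card = m := by rw [card_addBox hA]; omega
        by_cases hB : addBox μ r ≤ ν
        · simp [hA, hB, card_addBox hA, show μ.card + (m + 1) - (μ.card + 1) = m by omega]
        · simp [hA, hB]
      · simp [hA]
  · rw [gg_of_not hle, mul_zero]
    symm
    apply Finset.sum_eq_zero
    intro τ hτ
    simp only [Finset.mem_filter, mem_below] at hτ
    exact absurd (hτ.2.1.trans hτ.1) hle

theorem aval_eq {n : ℕ} {μ ρ : YoungDiagram} (hμ : μ.colLen 0 ≤ n) (hρ : ρ.colLen 0 ≤ n) :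
    aval n μ ρ = aval n ρ ρ * gg μ ρ := by
  classical
  by_cases hle : μ ≤ ρ
  swap
  · rw [aval_zero hμ hle, gg_of_not hle, mul_zero]
  obtain ⟨d, hd⟩ : ∃ d, ρ.card = μ.card + d := ⟨_, (Nat.add_sub_of_le (card_le_of_le hle)).symm⟩
  induction d generalizing μ with
  | zero =>
    rw [eq_of_le_card hle (by omega), gg_self, mul_one]
  | succ d ih =>
    have h1 := aval_pieri hμ hρ
    have h2 := gg_rec (μ := μ) (ν := ρ)
    rw [sum_covers hρ (fun τ => aval n τ ρ) hμ (fun τ h1 h2 => aval_zero h1 h2)] at h1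
    have h3 : ∑ τ ∈ (below ρ).filter (Covers μ), aval n τ ρ =
        aval n ρ ρ * ∑ τ ∈ (below ρ).filter (Covers μ), gg τ ρ := by
      rw [Finset.mul_sum]
      refine Finset.sum_congr rfl fun τ hτ => ?_
      simp only [Finset.mem_filter, mem_below] at hτ
      apply ih (colLen_mono hτ.1 hρ) hτ.1
      have := hτ.2.2
      omega
    have hne : ((ρ.card : ℚ) - μ.card) ≠ 0 := by
      rw [hd]; push_cast
      have : (0 : ℚ) ≤ d := by positivity
      intro h; linarith
    apply mul_left_cancel₀ hne
    rw [h1, h3, ← h2]; ring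

open Classical in
lemma gg_rec' {μ ν : YoungDiagram} :
    ((ν.card : ℚ) - μ.card) * gg μ ν = ∑ τ ∈ (below ν).filter (fun τ => Covers τ ν), gg μ τ := by
  by_cases hle : μ ≤ ν
  swap
  · rw [gg_of_not hle, mul_zero]
    symm
    apply Finset.sum_eq_zero
    intro τ hτ
    simp only [Finset.mem_filter, mem_below] at hτ
    exact gg_of_not fun h => hle (h.trans hτ.1)
  obtain ⟨d, hd⟩ : ∃ d, ν.card = μ.card + d := ⟨_, (Nat.add_sub_of_le (card_le_of_le hle)).symm⟩
  induction d generalizing μ ν with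
  | zero =>
    have : ((ν.card : ℚ) - μ.card) = 0 := by rw [hd]; simp
    rw [this, zero_mul]
    symm
    apply Finset.sum_eq_zero
    intro τ hτ
    simp only [Finset.mem_filter, mem_below] at hτ
    apply gg_of_not
    intro h
    have h1 := card_le_of_le h
    have h2 := hτ.2.2
    omega
  | succ d ih =>
    rcases Nat.eq_zero_or_pos d with rfl | hd0
    · -- cover
      have hcov : Covers μ ν := ⟨hle, by omega⟩
      rw [gg_rec, Finset.sum_eq_single ν, Finset.sum_eq_single μ]
      · rw [gg_self, gg_self]
      · intro τ hτ hne
        simp only [Finset.mem_filter, mem_below] at hτ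
        apply gg_of_not
        intro h
        have h2 := hτ.2.2
        exact hne (eq_of_le_card h (by omega)).symm
      · intro h
        exact absurd (Finset.mem_filter.2 ⟨mem_below.2 hle, hcov⟩) h
      · intro τ hτ hne
        simp only [Finset.mem_filter, mem_below] at hτ
        have h2 := hτ.2.2
        exact absurd (eq_of_le_card hτ.1 (by omega)) hne
      · intro h
        exact absurd (Finset.mem_filter.2 ⟨mem_below.2 le_rfl, hcov⟩) h
    · have hdne : (d : ℚ) ≠ 0 := by exact_mod_cast hd0.ne'
      apply mul_left_cancel₀ hdne
      rw [gg_rec, Finset.mul_sum, Finset.mul_sum]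
      have e1 : ∀ τ ∈ (below ν).filter (Covers μ), (d : ℚ) * gg τ ν =
          ∑ κ ∈ (below ν).filter (fun τ => Covers τ ν), gg τ κ := by
        intro τ hτ
        simp only [Finset.mem_filter, mem_below] at hτ
        have h2 := hτ.2.2
        rw [← ih hτ.1 (by omega), hd, h2]
        push_cast; ring
      have e2 : ∀ κ ∈ (below ν).filter (fun τ => Covers τ ν), (d : ℚ) * gg μ κ =
          ∑ τ ∈ (below ν).filter (Covers μ), gg τ κ := by
        intro κ hκ
        simp only [Finset.mem_filter, mem_below] at hκ
        have h2 := hκ.2.2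
        have e3 : (d : ℚ) = (κ.card : ℚ) - μ.card := by
          have : κ.card = μ.card + d := by omega
          rw [this]; push_cast; ring
        rw [e3, gg_rec]
        apply Finset.sum_subset
        · intro τ
          simp only [Finset.mem_filter, mem_below]
          exact fun h => ⟨h.1.trans hκ.1, h.2⟩
        · intro τ h1 h2
          simp only [Finset.mem_filter, mem_below] at h1 h2
          exact gg_of_not fun h => h2 ⟨h, h1.2⟩
      rw [Finset.sum_congr rfl e1, Finset.sum_congr rfl e2, Finset.sum_comm]

theorem gg_inv (μ ν : YoungDiagram) :
    ∑ ρ ∈ below ν, gg μ ρ * ((-1 : ℚ) ^ (ν.card - ρ.card) * gg ρ ν) =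
      open Classical in if μ = ν then 1 else 0 := by
  classical
  by_cases hle : μ ≤ ν
  swap
  · rw [if_neg (fun h => hle h.le)]
    apply Finset.sum_eq_zero
    intro ρ hρ
    rw [mem_below] at hρ
    rw [gg_of_not fun h => hle (h.trans hρ), zero_mul]
  by_cases heq : μ = ν
  · subst heq
    rw [if_pos rfl, Finset.sum_eq_single μ]
    · simp [gg_self]
    · intro ρ hρ hne
      rw [mem_below] at hρ
      rw [gg_of_not fun h => hne (le_antisymm hρ h), zero_mul]
    · intro h; exact absurd (mem_below.2 le_rfl) h
  · rw [if_neg heq]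
    have hcard : ((ν.card : ℚ) - μ.card) ≠ 0 := by
      intro h
      apply heq
      apply eq_of_le_card hle
      have : (ν.card : ℚ) = μ.card := by linarith
      exact (Nat.cast_injective this).le
    apply mul_left_cancel₀ hcard
    rw [mul_zero, Finset.mul_sum]
    have e : ∀ ρ ∈ below ν, ((ν.card : ℚ) - μ.card) *
        (gg μ ρ * ((-1 : ℚ) ^ (ν.card - ρ.card) * gg ρ ν)) =
        (∑ τ ∈ below ν, if Covers ρ τ then
          gg μ ρ * ((-1 : ℚ) ^ (ν.card - ρ.card) * gg τ ν) else 0) +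
        ∑ τ ∈ below ν, if Covers τ ρ then
          gg μ τ * ((-1 : ℚ) ^ (ν.card - ρ.card) * gg ρ ν) else 0 := by
      intro ρ hρ
      rw [mem_below] at hρ
      have h1 := gg_rec (μ := ρ) (ν := ν)
      have h2 := gg_rec' (μ := μ) (ν := ρ)
      have h3 : ∑ τ ∈ (below ρ).filter (fun τ => Covers τ ρ), gg μ τ =
          ∑ τ ∈ (below ν).filter (fun τ => Covers τ ρ), gg μ τ := by
        congr 1
        ext τ
        simp only [Finset.mem_filter, mem_below]
        exact ⟨fun h => ⟨h.1.trans hρ, h.2⟩, fun h => ⟨h.2.1, h.2⟩⟩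
      rw [← Finset.sum_filter, ← Finset.sum_filter, ← Finset.mul_sum, ← Finset.mul_sum,
        ← Finset.sum_mul, ← h1, ← h3, ← h2]
      ring
    rw [Finset.sum_congr rfl e, Finset.sum_add_distrib]
    nth_rewrite 2 [Finset.sum_comm]
    rw [← Finset.sum_add_distrib]
    apply Finset.sum_eq_zero
    intro ρ _
    rw [← Finset.sum_add_distrib]
    apply Finset.sum_eq_zero
    intro τ hτ
    rw [mem_below] at hτ
    split_ifs with hc
    · have h1 := card_le_of_le hτ
      have h2 := hc.2
      have : ν.card - ρ.card = (ν.card - τ.card) + 1 := by omega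
      rw [this, pow_succ]; ring
    · simp

end FactorialLR

namespace FactorialLR
open MvPolynomial

section main
variable {n : ℕ}

/-- indicator of a diagram -/
noncomputable def ind (κ : YoungDiagram) : YoungDiagram → ℚ :=
  open Classical in fun τ => if τ = κ then 1 else 0

lemma ind_self (κ : YoungDiagram) : ind κ κ = 1 := by simp [ind]

lemma ind_ne {κ τ : YoungDiagram} (h : τ ≠ κ) : ind κ τ = 0 := by simp [ind, h]

/-- coefficients in tableau form -/
noncomputable def fV (n : ℕ) (lam κ μ : YoungDiagram) : ℚ :=
  V (n := n) lam.colLen (ind κ) (lam.rowLen 0) ∅ μ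

noncomputable def SS (n : ℕ) (lam ρ : YoungDiagram) : ℚ :=
  eval (fun i : Fin n => (kv n ρ i : ℚ)) (Z lam.colLen (lam.rowLen 0) ∅)

theorem SS_gg (lam : YoungDiagram) {μ ρ : YoungDiagram} (hμ : μ.colLen 0 ≤ n)
    (hρ : ρ.colLen 0 ≤ n) :
    SS n lam ρ * gg μ ρ = ∑ κ ∈ below ρ, fV n lam κ μ * gg κ ρ := by
  classical
  have h1 := V_alt (fun i : Fin n => (kv n ρ i : ℚ)) lam.colLen
    (fun τ => ∑ κ ∈ below ρ, aval n κ ρ * ind κ τ) (by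
      intro τ hτ
      change _ = aval n τ ρ
      by_cases hle : τ ≤ ρ
      · rw [Finset.sum_eq_single τ, ind_self, mul_one]
        · intro κ _ hne
          rw [ind_ne hne.symm, mul_zero]
        · intro h; exact absurd (mem_below.2 hle) h
      · rw [aval_zero hτ hle]
        apply Finset.sum_eq_zero
        intro κ hκ
        rw [ind_ne, mul_zero]
        rintro rfl
        exact hle (mem_below.1 hκ)) (lam.rowLen 0) ∅ hμ
  rw [V_sum, AE_sym_mul (Z_sym _ _)] at h1
  change _ = SS n lam ρ * aval n μ ρ at h1
  rw [aval_eq hμ hρ] at h1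
  apply mul_left_cancel₀ (aval_self (n := n) ρ)
  rw [show aval n ρ ρ * (SS n lam ρ * gg μ ρ) = SS n lam ρ * (aval n ρ ρ * gg μ ρ) by ring, ← h1,
    Finset.mul_sum]
  refine Finset.sum_congr rfl fun κ hκ => ?_
  rw [aval_eq (colLen_mono (mem_below.1 hκ) hρ) hρ, fV]
  ring

lemma Z_vanish (ρ : YoungDiagram) (h : ℕ → ℕ) (j : ℕ) (γ : Finset (Fin n))
    (hne : eval (fun v : Fin n => (kv n ρ (Fin.rev v) : ℚ)) (Z h j γ) ≠ 0) :
    (∀ v ∈ γ, j ≤ ρ.rowLen (n - 1 - v)) ∧ ∀ i < j, h i ≤ ρ.colLen i := by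
  induction j generalizing γ with
  | zero => exact ⟨fun _ _ => Nat.zero_le _, fun _ hi => absurd hi (Nat.not_lt_zero _)⟩
  | succ j ih =>
    rw [Z, map_sum] at hne
    obtain ⟨δ, hδ, hne⟩ := Finset.exists_ne_zero_of_sum_ne_zero hne
    rw [Finset.mem_filter] at hδ
    obtain ⟨-, hcard, hdom⟩ := hδ
    rw [map_mul] at hne
    obtain ⟨h1, h2⟩ := ih δ (right_ne_zero_of_mul hne)
    have h3 := left_ne_zero_of_mul hne
    rw [colW, map_prod, Finset.prod_ne_zero_iff] at h3
    rcases δ.eq_empty_or_nonempty with rfl | hδ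
    · have hγ : ∀ v ∈ γ, False := by
        intro v hv
        have := hdom v
        simp only [Finset.filter_empty, Finset.card_empty, Nat.le_zero,
          Finset.card_eq_zero] at this
        exact Finset.notMem_empty v (this ▸ Finset.mem_filter.2 ⟨hv, le_rfl⟩)
      refine ⟨fun v hv => (hγ v hv).elim, fun i hi => ?_⟩
      rcases Nat.lt_succ_iff_lt_or_eq.1 hi with hi | rfl
      · exact h2 i hi
      · rw [← hcard]; simp
    · set t := δ.min' hδ with ht
      have htm : t ∈ δ := Finset.min'_mem _ _
      have hpos : pos δ t = 0 := by
        unfold pos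
        rw [Finset.card_eq_zero, Finset.filter_eq_empty_iff]
        intro u hu
        exact not_lt.2 (Finset.min'_le _ _ hu)
      have h4 := h3 t htm
      have h5 := h1 t htm
      have htn := t.2
      have h6 : j < ρ.rowLen (n - 1 - t) := by
        refine lt_of_le_of_ne h5 fun heq => h4 ?_
        simp only [map_sub, eval_X, eval_C, bw, hpos, kv, Fin.val_rev]
        rw [show n - ((t : ℕ) + 1) = n - 1 - t by omega, ← heq,
          show n - 1 - (n - 1 - (t : ℕ)) = t by omega]
        push_cast; ring
      have hmin : ∀ v ∈ γ, t ≤ v := by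
        intro v hv
        have h7 := hdom v
        have h8 : 0 < (γ.filter (· ≤ v)).card :=
          Finset.card_pos.2 ⟨v, Finset.mem_filter.2 ⟨hv, le_rfl⟩⟩
        obtain ⟨u, hu⟩ := Finset.card_pos.1 (h8.trans_le h7)
        rw [Finset.mem_filter] at hu
        exact (Finset.min'_le _ _ hu.1).trans hu.2
      refine ⟨fun v hv => ?_, fun i hi => ?_⟩
      · have h9 : (t : ℕ) ≤ v := hmin v hv
        have := ρ.rowLen_anti (n - 1 - v) (n - 1 - t) (by omega)
        omega
      rcases Nat.lt_succ_iff_lt_or_eq.1 hi with hi | rfl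
      · exact h2 i hi
      · rw [← hcard]
        have h7 : (n - 1 - (t : ℕ), i) ∈ ρ := YoungDiagram.mem_iff_lt_rowLen.2 h6
        rw [YoungDiagram.mem_iff_lt_colLen] at h7
        have h8 : δ.card ≤ (Finset.Ici t).card := by
          apply Finset.card_le_card
          intro u hu
          exact Finset.mem_Ici.2 (Finset.min'_le _ _ hu)
        rw [Fin.card_Ici] at h8
        omega

lemma SS_vanish {lam ρ : YoungDiagram} (h : ¬ lam ≤ ρ) : SS n lam ρ = 0 := by
  by_contra hne
  apply h
  unfold SS at hne
  rw [← eval_perm (Z_sym _ _) Fin.revPerm] at hne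
  have h1 := (Z_vanish ρ _ _ _ hne).2
  intro c hc
  obtain ⟨a, b⟩ := c
  have hb : b < lam.rowLen 0 := by
    have h2 := YoungDiagram.mem_iff_lt_rowLen.1 hc
    exact h2.trans_le (lam.rowLen_anti 0 a (Nat.zero_le _))
  have h3 := YoungDiagram.mem_iff_lt_colLen.1 hc
  exact YoungDiagram.mem_iff_lt_colLen.2 (h3.trans_le (h1 b hb))

lemma proc_deg (l : List (Fin n × ℚ)) (c : YoungDiagram → ℚ) (N m : ℕ)
    (hc : ∀ τ : YoungDiagram, τ.card + m < N → c τ = 0) (μ : YoungDiagram)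
    (h : μ.card + l.length + m < N) : proc l c μ = 0 := by
  induction l generalizing μ with
  | nil => exact hc μ (by simpa using h)
  | cons a l ih =>
    obtain ⟨r, b⟩ := a
    simp only [List.length_cons] at h
    rw [proc, ih μ (by omega), mul_zero, zero_add]
    split_ifs with hA
    · exact ih _ (by rw [card_addBox hA]; omega)
    · rfl

lemma length_colList (j : ℕ) (δ : Finset (Fin n)) : (colList j δ).length = δ.card := by
  simp [colList]

lemma V_deg (h : ℕ → ℕ) (κ : YoungDiagram) (j : ℕ) (γ : Finset (Fin n)) (μ : YoungDiagram)
    (hd : μ.card + ∑ i ∈ Finset.range j, h i < κ.card) : V h (ind κ) j γ μ = 0 := by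
  induction j generalizing γ μ with
  | zero =>
    rw [V, ind_ne]
    rintro rfl
    simp at hd
  | succ j ih =>
    rw [V]
    apply Finset.sum_eq_zero
    intro δ hδ
    rw [Finset.mem_filter] at hδ
    apply proc_deg _ _ κ.card (∑ i ∈ Finset.range j, h i) (fun τ hτ => ih δ τ hτ)
    rw [length_colList, hδ.2.1]
    rw [Finset.sum_range_succ] at hd
    omega

open Classical in
lemma proc_top (l : List (Fin n × ℚ)) (hl : l.Pairwise (fun a b => a.1 < b.1))
    (c : YoungDiagram → ℚ) (N m : ℕ)
    (hc : ∀ τ : YoungDiagram, τ.card + m < N → c τ = 0) (μ : YoungDiagram)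
    (h : μ.card + l.length + m = N) :
    (∀ τ : YoungDiagram, (∀ v : ℕ, τ.rowLen v = μ.rowLen v +
      if ∃ a ∈ l, (a.1 : ℕ) = v then 1 else 0) → proc l c μ = c τ) ∧
    ((¬ ∃ τ : YoungDiagram, ∀ v : ℕ, τ.rowLen v = μ.rowLen v +
      if ∃ a ∈ l, (a.1 : ℕ) = v then 1 else 0) → proc l c μ = 0) := by
  induction l generalizing μ with
  | nil =>
    constructor
    · intro τ hτ
      rw [yd_ext (μ := τ) (ν := μ) (by simpa using hτ)]; rfl
    · intro hno
      exact absurd ⟨μ, by simp⟩ hno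
  | cons a l ih =>
    obtain ⟨r, b⟩ := a
    simp only [List.length_cons] at h
    rw [List.pairwise_cons] at hl
    have hlr : ∀ a ∈ l, (r : ℕ) < a.1 := fun a ha => hl.1 a ha
    rw [proc, proc_deg l c N m hc μ (by omega), mul_zero, zero_add]
    have key : ∀ (hA : Addable μ r) (v : ℕ), (addBox μ r).rowLen v +
        (if ∃ a ∈ l, (a.1 : ℕ) = v then 1 else 0) = μ.rowLen v +
        if ∃ a ∈ (r, b) :: l, (a.1 : ℕ) = v then 1 else 0 := by
      intro hA v
      rw [rowLen_addBox hA]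
      by_cases hv : v = r
      · subst hv
        rw [if_pos rfl, if_neg, if_pos]
        · exact ⟨(r, b), by simp, rfl⟩
        · rintro ⟨a, ha, hav⟩
          have := hlr a ha
          omega
      · have : (∃ a ∈ (r, b) :: l, (a.1 : ℕ) = v) ↔ (∃ a ∈ l, (a.1 : ℕ) = v) := by
          simp only [List.mem_cons, exists_eq_or_imp]
          exact or_iff_right (fun h => hv h.symm)
        rw [if_neg hv]
        simp only [this, add_zero]
    by_cases hA : Addable μ r
    · rw [if_pos hA]
      have := ih hl.2 (addBox μ r) (by rw [card_addBox hA]; omega)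
      simp only [key hA] at this
      exact this
    · rw [if_neg hA]
      refine ⟨fun τ hτ => (hA ?_).elim, fun _ => rfl⟩
      unfold Addable
      by_cases hr : (r : ℕ) = 0
      · exact Or.inl hr
      right
      have h1 := hτ r
      rw [if_pos ⟨(r, b), by simp, rfl⟩] at h1
      have h2 := hτ (r - 1)
      rw [if_neg] at h2
      · have := τ.rowLen_anti (r - 1) r (by omega)
        omega
      · rintro ⟨a, ha, hav⟩
        rw [List.mem_cons] at ha
        rcases ha with rfl | ha
        · simp at hav; omega
        · have := hlr a ha
          omega

/-- `lam` with the first `j` columns removed -/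
def cut (lam : YoungDiagram) (j : ℕ) : YoungDiagram :=
  ⟨(lam.cells.filter (fun c => j ≤ c.2)).image (fun c => (c.1, c.2 - j)), by
    intro a b hba ha
    simp only [Finset.coe_image, Finset.coe_filter, Set.mem_image, Set.mem_ofPred_eq] at ha ⊢
    obtain ⟨c, ⟨hc, hj⟩, rfl⟩ := ha
    refine ⟨(b.1, b.2 + j), ⟨?_, by simp⟩, by simp⟩
    rw [YoungDiagram.mem_cells] at hc ⊢
    obtain ⟨c1, c2⟩ := c
    obtain ⟨b1, b2⟩ := b
    have h1 : b1 ≤ c1 ∧ b2 ≤ c2 - j := hba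
    simp only at hj
    exact lam.up_left_mem h1.1 (by simp only; omega) hc⟩

lemma rowLen_cut (lam : YoungDiagram) (j i : ℕ) : (cut lam j).rowLen i = lam.rowLen i - j := by
  have key : ∀ k, k < (cut lam j).rowLen i ↔ k < lam.rowLen i - j := by
    intro k
    rw [← YoungDiagram.mem_iff_lt_rowLen]
    change (i, k) ∈ (lam.cells.filter (fun c => j ≤ c.2)).image (fun c => (c.1, c.2 - j)) ↔ _
    simp only [Finset.mem_image, Finset.mem_filter, YoungDiagram.mem_cells, Prod.mk.injEq]
    constructor
    · rintro ⟨⟨a, b⟩, ⟨hc, hj⟩, rfl, rfl⟩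
      rw [YoungDiagram.mem_iff_lt_rowLen] at hc
      simp only at hj ⊢; omega
    · intro hk
      refine ⟨(i, k + j), ⟨?_, by simp⟩, rfl, by simp⟩
      rw [YoungDiagram.mem_iff_lt_rowLen]; omega
  have h1 := key ((cut lam j).rowLen i)
  have h2 := key (lam.rowLen i - j)
  omega

lemma cut_zero (lam : YoungDiagram) : cut lam 0 = lam := yd_ext fun i => by simp [rowLen_cut]

lemma rowLen_bot (i : ℕ) : (⊥ : YoungDiagram).rowLen i = 0 := by
  by_contra hc
  have h1 : (i, 0) ∈ (⊥ : YoungDiagram) := by rw [YoungDiagram.mem_iff_lt_rowLen]; omega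
  exact YoungDiagram.notMem_bot _ h1

lemma cut_top (lam : YoungDiagram) : cut lam (lam.rowLen 0) = ⊥ := yd_ext fun i => by
  rw [rowLen_cut, rowLen_bot]
  have := lam.rowLen_anti 0 i (Nat.zero_le _)
  omega

lemma lt_row_iff (lam : YoungDiagram) (i j : ℕ) : j < lam.rowLen i ↔ i < lam.colLen j := by
  rw [← YoungDiagram.mem_iff_lt_rowLen, ← YoungDiagram.mem_iff_lt_colLen]

lemma card_cut {lam : YoungDiagram} (hl : lam.colLen 0 ≤ n) (j : ℕ) :
    (cut lam j).card + ∑ i ∈ Finset.range j, lam.colLen i = lam.card := by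
  induction j with
  | zero => simp [cut_zero]
  | succ j ih =>
    rw [← ih, Finset.sum_range_succ]
    have hcut : ∀ j, (cut lam j).colLen 0 ≤ n := fun j => by
      apply colLen_le_of; rw [rowLen_cut, rowLen_eq_zero_of hl le_rfl]; simp
    rw [card_eq_sum (hcut _), card_eq_sum (hcut _)]
    have h1 : ∀ i, (cut lam j).rowLen i = (cut lam (j + 1)).rowLen i +
        if i < lam.colLen j then 1 else 0 := by
      intro i
      rw [rowLen_cut, rowLen_cut]
      have := lt_row_iff lam i j
      split_ifs <;> omega
    have h2 : lam.colLen j ≤ n := (lam.colLen_anti 0 j (Nat.zero_le _)).trans hl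
    simp only [h1, Finset.sum_add_distrib]
    have h3 : (∑ i ∈ Finset.range n, if i < lam.colLen j then 1 else 0) = lam.colLen j := by
      rw [← Finset.sum_filter, Finset.sum_const, smul_eq_mul, mul_one]
      have : (Finset.range n).filter (fun i => i < lam.colLen j) = Finset.range (lam.colLen j) := by
        ext i; simp only [Finset.mem_filter, Finset.mem_range]; omega
      rw [this, Finset.card_range]
    omega

lemma card_sum_cols {lam : YoungDiagram} :
    ∑ i ∈ Finset.range (lam.rowLen 0), lam.colLen i = lam.card := by
  have := card_cut (lam := lam) le_rfl (lam.rowLen 0)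
  rw [cut_top] at this
  have h0 : (⊥ : YoungDiagram).card = 0 := by simp [YoungDiagram.card]
  omega

/-- initial segments -/
def initS (n m : ℕ) : Finset (Fin n) := Finset.univ.filter (fun v : Fin n => (v : ℕ) < m)

lemma card_initS {m : ℕ} (h : m ≤ n) : (initS n m).card = m := by
  unfold initS
  rw [Fin.card_filter_val_lt]; omega

lemma mem_initS {m : ℕ} {v : Fin n} : v ∈ initS n m ↔ (v : ℕ) < m := by simp [initS]

lemma colList_pairwise (j : ℕ) (δ : Finset (Fin n)) :
    (colList j δ).Pairwise (fun a b => a.1 < b.1) := by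
  unfold colList
  rw [List.pairwise_map]
  exact Finset.sortedLT_sort δ |>.pairwise

lemma mem_colList (j : ℕ) (δ : Finset (Fin n)) (v : ℕ) :
    (∃ a ∈ colList j δ, (a.1 : ℕ) = v) ↔ ∃ u ∈ δ, (u : ℕ) = v := by
  unfold colList
  simp

lemma eq_initS {δ : Finset (Fin n)} {m : ℕ} (hc : δ.card = m)
    (hl : ∀ v : ℕ, ∀ h : v + 1 < n, (⟨v + 1, h⟩ : Fin n) ∈ δ → (⟨v, by omega⟩ : Fin n) ∈ δ) :
    δ = initS n m := by
  have hlow : ∀ (k v : ℕ) (h : v + k < n), (⟨v + k, h⟩ : Fin n) ∈ δ →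
      (⟨v, by omega⟩ : Fin n) ∈ δ := by
    intro k
    induction k with
    | zero => intro v h hm; exact hm
    | succ k ih =>
      intro v h hm
      exact ih v (by omega) (hl (v + k) h hm)
  have hm : m ≤ n := by rw [← hc]; simpa using Finset.card_le_univ δ
  apply Finset.eq_of_subset_of_card_le
  · intro u hu
    rw [mem_initS]
    have h1 : Finset.Iic u ⊆ δ := by
      intro v hv
      have h2 : (v : ℕ) ≤ u := Fin.le_def.1 (Finset.mem_Iic.1 hv)
      have := hlow (u - v) v (by have := u.2; omega) (by
        have h3 : (⟨(v : ℕ) + (u - v), by have := u.2; omega⟩ : Fin n) = u := Fin.ext (by simp; omega)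
        rw [h3]; exact hu)
      exact this
    have := Finset.card_le_card h1
    rw [Fin.card_Iic] at this
    omega
  · rw [card_initS hm, hc]

lemma V_one {lam : YoungDiagram} (hl : lam.colLen 0 ≤ n) (j : ℕ) :
    V lam.colLen (ind lam) j (initS n (lam.colLen j)) (cut lam j) = 1 := by
  classical
  induction j with
  | zero => rw [V, cut_zero, ind_self]
  | succ j ih =>
    have hj : lam.colLen j ≤ n := (lam.colLen_anti 0 j (Nat.zero_le _)).trans hl
    have hjj : lam.colLen (j + 1) ≤ lam.colLen j := lam.colLen_anti j (j + 1) (by omega)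
    have htop := fun (δ : Finset (Fin n)) (hδ : δ.card = lam.colLen j) =>
      proc_top (colList j δ) (colList_pairwise j δ) (V lam.colLen (ind lam) j δ) lam.card
        (∑ i ∈ Finset.range j, lam.colLen i)
        (fun τ hτ => V_deg lam.colLen lam j δ τ hτ) (cut lam (j + 1)) (by
          rw [length_colList, hδ, ← card_cut hl (j + 1), Finset.sum_range_succ]; ring)
    rw [V]; beta_reduce
    rw [Finset.sum_eq_single (initS n (lam.colLen j))]
    · rw [(htop _ (card_initS hj)).1 (cut lam j), ih]
      intro v
      rw [rowLen_cut, rowLen_cut]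
      have h1 := lt_row_iff lam v j
      have h2 : (∃ a ∈ colList j (initS n (lam.colLen j)), (a.1 : ℕ) = v) ↔ v < lam.colLen j := by
        rw [mem_colList]
        constructor
        · rintro ⟨u, hu, rfl⟩
          exact mem_initS.1 hu
        · intro h
          exact ⟨⟨v, by omega⟩, mem_initS.2 h, rfl⟩
      by_cases h3 : v < lam.colLen j
      · rw [if_pos (h2.2 h3)]; clear h2; omega
      · rw [if_neg (fun h => h3 (h2.1 h))]; clear h2; omega
    · intro δ hδ hne
      rw [Finset.mem_filter] at hδ
      obtain ⟨-, hcard, hdom⟩ := hδ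
      apply (htop δ hcard).2
      rintro ⟨τ, hτ⟩
      apply hne
      simp only [mem_colList] at hτ
      apply eq_initS hcard
      intro v hv hm
      by_cases hvj : v < lam.colLen (j + 1)
      · have h1 := hdom ⟨v, by omega⟩
        have h2 : (initS n (lam.colLen (j + 1))).filter (· ≤ (⟨v, by omega⟩ : Fin n)) =
            Finset.Iic ⟨v, by omega⟩ := by
          ext u
          simp only [Finset.mem_filter, mem_initS, Finset.mem_Iic, Fin.le_def]
          omega
        rw [h2] at h1
        have h3 : δ.filter (· ≤ (⟨v, by omega⟩ : Fin n)) = Finset.Iic ⟨v, by omega⟩ := by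
          apply Finset.eq_of_subset_of_card_le _ h1
          intro u hu
          exact Finset.mem_Iic.2 (Finset.mem_filter.1 hu).2
        have h4 : (⟨v, by omega⟩ : Fin n) ∈ δ.filter (· ≤ (⟨v, by omega⟩ : Fin n)) := by
          rw [h3]; exact Finset.mem_Iic.2 le_rfl
        exact (Finset.mem_filter.1 h4).1
      · have h1 := hτ v
        have h2 := hτ (v + 1)
        rw [if_pos ⟨_, hm, rfl⟩] at h2
        have h3 := τ.rowLen_anti v (v + 1) (by omega)
        rw [rowLen_cut] at h1
        have h4 := lt_row_iff lam v (j + 1)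
        by_contra hnot
        rw [if_neg] at h1
        · omega
        · rintro ⟨u, hu, huv⟩
          apply hnot
          have : u = ⟨v, by omega⟩ := Fin.ext huv
          rw [← this]; exact hu
    · intro hnot
      exfalso
      apply hnot
      rw [Finset.mem_filter]
      refine ⟨Finset.mem_univ _, card_initS hj, fun v => ?_⟩
      apply Finset.card_le_card
      intro u
      simp only [Finset.mem_filter, mem_initS]
      rintro ⟨h1, h2⟩
      exact ⟨by omega, h2⟩

lemma colLen_rowLen_zero (lam : YoungDiagram) : lam.colLen (lam.rowLen 0) = 0 := by
  have := lt_row_iff lam 0 (lam.rowLen 0)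
  omega

lemma fV_one {lam : YoungDiagram} (hl : lam.colLen 0 ≤ n) : fV n lam lam ⊥ = 1 := by
  have := V_one hl (lam.rowLen 0)
  rw [cut_top, colLen_rowLen_zero] at this
  have h0 : initS n 0 = ∅ := by simp [initS]
  rw [h0] at this
  exact this

lemma colLen_bot : (⊥ : YoungDiagram).colLen 0 ≤ n := colLen_le_of (rowLen_bot n)

lemma fV_bot {lam : YoungDiagram} (κ : YoungDiagram) (hκ : κ.colLen 0 ≤ n) (hne : κ ≠ lam) :
    fV n lam κ ⊥ = 0 := by
  induction hN : κ.card using Nat.strong_induction_on generalizing κ with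
  | _ N ih =>
    by_cases hle : lam ≤ κ
    · apply V_deg
      rw [card_sum_cols]
      have h0 : (⊥ : YoungDiagram).card = 0 := by simp [YoungDiagram.card]
      rw [h0, zero_add]
      by_contra hc
      exact hne (eq_of_le_card hle (by omega)).symm
    · have h1 := SS_gg lam (n := n) colLen_bot hκ (μ := ⊥)
      rw [SS_vanish hle, zero_mul, Finset.sum_eq_single κ, gg_self, mul_one] at h1
      · exact h1.symm
      · intro κ' hκ' hne'
        have h2 := mem_below.1 hκ'
        rw [ih κ'.card _ κ' (colLen_mono h2 hκ) _ rfl, zero_mul]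
        · rw [← hN]
          by_contra hc
          exact hne' (eq_of_le_card h2 (by omega))
        · rintro rfl; exact hle h2
      · intro h; exact absurd (mem_below.2 le_rfl) h

theorem SS_bot {lam ρ : YoungDiagram} (hl : lam.colLen 0 ≤ n) (hρ : ρ.colLen 0 ≤ n) :
    SS n lam ρ * gg ⊥ ρ = gg lam ρ := by
  rw [SS_gg lam colLen_bot hρ]
  by_cases hle : lam ≤ ρ
  · rw [Finset.sum_eq_single lam, fV_one hl, one_mul]
    · intro κ hκ hne
      rw [fV_bot κ (colLen_mono (mem_below.1 hκ) hρ) hne, zero_mul]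
    · intro h; exact absurd (mem_below.2 hle) h
  · rw [gg_of_not hle]
    apply Finset.sum_eq_zero
    intro κ hκ
    rw [fV_bot κ (colLen_mono (mem_below.1 hκ) hρ), zero_mul]
    rintro rfl
    exact hle (mem_below.1 hκ)

lemma gg_bot_ne (ρ : YoungDiagram) : gg ⊥ ρ ≠ 0 := by
  have := SS_bot (n := ρ.colLen 0) (lam := ρ) (ρ := ρ) le_rfl le_rfl
  rw [gg_self] at this
  exact right_ne_zero_of_mul (by rw [this]; exact one_ne_zero)

/-- the inversion: tableau coefficients in terms of dimensions -/
theorem fV_eq {lam μ ν : YoungDiagram} (hl : lam.colLen 0 ≤ n) (hμ : μ.colLen 0 ≤ n)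
    (hν : ν.colLen 0 ≤ n) :
    fV n lam ν μ = ∑ ρ ∈ below ν, (-1 : ℚ) ^ (ν.card - ρ.card) *
      ((gg ⊥ ρ)⁻¹ * (gg ρ ν * gg lam ρ * gg μ ρ)) := by
  classical
  have h1 : ∀ ρ ∈ below ν, (-1 : ℚ) ^ (ν.card - ρ.card) *
      ((gg ⊥ ρ)⁻¹ * (gg ρ ν * gg lam ρ * gg μ ρ)) =
      ∑ κ ∈ below ν, fV n lam κ μ * (gg κ ρ * ((-1 : ℚ) ^ (ν.card - ρ.card) * gg ρ ν)) := by
    intro ρ hρ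
    have hρ' := mem_below.1 hρ
    have hρn := colLen_mono hρ' hν
    rw [← SS_bot hl hρn]
    have h2 := gg_bot_ne ρ
    rw [show (-1 : ℚ) ^ (ν.card - ρ.card) *
      ((gg ⊥ ρ)⁻¹ * (gg ρ ν * (SS n lam ρ * gg ⊥ ρ) * gg μ ρ)) =
      ((gg ⊥ ρ)⁻¹ * gg ⊥ ρ) * ((-1 : ℚ) ^ (ν.card - ρ.card) * gg ρ ν) * (SS n lam ρ * gg μ ρ) by ring,
      inv_mul_cancel₀ h2, one_mul, SS_gg lam hμ hρn, Finset.mul_sum]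
    rw [Finset.sum_subset (s₁ := below ρ) (s₂ := below ν)]
    · exact Finset.sum_congr rfl fun κ _ => by ring
    · intro κ hκ
      exact mem_below.2 ((mem_below.1 hκ).trans hρ')
    · intro κ _ hκ
      rw [gg_of_not (fun h => hκ (mem_below.2 h))]; ring
  rw [Finset.sum_congr rfl h1, Finset.sum_comm]
  simp only [← Finset.mul_sum, gg_inv]
  rw [Finset.sum_eq_single ν]
  · simp
  · intro κ _ hne; simp [hne]
  · intro h; exact absurd (mem_below.2 le_rfl) h

end main
end FactorialLR

namespace FactorialLR

section chains

lemma chain_le {μ ν : YoungDiagram} {L : List YoungDiagram} (hL : L ∈ chainSet μ ν) : μ ≤ ν := by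
  induction L generalizing μ with
  | nil => simp [chainSet] at hL
  | cons a L ih =>
    obtain ⟨h1, h2, h3⟩ := hL
    simp only [List.head?_cons, Option.some.injEq] at h2
    subst h2
    cases L with
    | nil => simp at h3; exact h3.le
    | cons b L =>
      have hc : Covers a b ∧ (b :: L).IsChain Covers := List.isChain_cons_cons.1 h1
      exact hc.1.1.trans (ih (μ := b) ⟨hc.2, rfl, by simpa using h3⟩)

lemma chain_cons {μ ν τ : YoungDiagram} {L : List YoungDiagram} :
    μ :: τ :: L ∈ chainSet μ ν ↔ Covers μ τ ∧ τ :: L ∈ chainSet τ ν := by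
  constructor
  · rintro ⟨h1, h2, h3⟩
    have hc : Covers μ τ ∧ (τ :: L).IsChain Covers := List.isChain_cons_cons.1 h1
    exact ⟨hc.1, hc.2, rfl, by simpa using h3⟩
  · rintro ⟨h, h1, h2, h3⟩
    exact ⟨List.isChain_cons_cons.2 ⟨h, h1⟩, rfl, by simpa using h3⟩

lemma chain_finite (μ ν : YoungDiagram) : (chainSet μ ν).Finite := by
  have key : ∀ N : ℕ, ∀ μ : YoungDiagram, ν.card ≤ μ.card + N → (chainSet μ ν).Finite := by
    intro N
    induction N with
    | zero =>
      intro μ hN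
      apply Set.Finite.subset (Set.finite_singleton [μ])
      rintro L hL
      rcases L with _ | ⟨a, _ | ⟨b, L⟩⟩
      · simp [chainSet] at hL
      · have := hL.2.1
        simp at this; simp [this]
      · have h2 := hL.2.1
        simp only [List.head?_cons, Option.some.injEq] at h2
        subst h2
        obtain ⟨h1, h2⟩ := chain_cons.1 hL
        have := card_le_of_le (chain_le h2)
        have := h1.2
        omega
    | succ N ih =>
      intro μ hN
      have hfin : ({[μ]} ∪ ⋃ τ ∈ {τ | τ ∈ below ν ∧ Covers μ τ},
          (List.cons μ) '' chainSet τ ν).Finite := by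
        apply Set.Finite.union (Set.finite_singleton _)
        apply Set.Finite.biUnion
        · apply Set.Finite.subset (below ν).finite_toSet
          intro τ h; exact h.1
        · intro τ h
          apply Set.Finite.image
          apply ih
          have := h.2.2
          omega
      apply hfin.subset
      intro L hL
      rcases L with _ | ⟨a, _ | ⟨b, L⟩⟩
      · simp [chainSet] at hL
      · have := hL.2.1
        simp at this; simp [this]
      · have h2 := hL.2.1
        simp only [List.head?_cons, Option.some.injEq] at h2
        subst h2
        obtain ⟨h1, h2⟩ := chain_cons.1 hL
        right
        simp only [Set.mem_iUnion]
        exact ⟨b, ⟨mem_below.2 (chain_le h2), h1⟩, b :: L, h2, rfl⟩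
  exact key ν.card μ (by omega)

noncomputable def chF (μ ν : YoungDiagram) : Finset (List YoungDiagram) := (chain_finite μ ν).toFinset

lemma mem_chF {μ ν : YoungDiagram} {L : List YoungDiagram} : L ∈ chF μ ν ↔ L ∈ chainSet μ ν := by
  simp [chF]

variable {α : Type*} {n : ℕ}

/-- sum over barrings, recursively -/
def QQ (T : α → Fin n) (wt : YoungDiagram → α → ℚ) : List α → List YoungDiagram → ℚ
  | [], L => if L.length = 1 then 1 else 0
  | _ :: _, [] => 0
  | c :: cs, [μ] => wt μ c * QQ T wt cs [μ]
  | c :: cs, μ :: τ :: L => wt μ c * QQ T wt cs (μ :: τ :: L) +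
      if (T c : ℕ) = stepRow μ τ then QQ T wt cs (τ :: L) else 0

lemma sum_QQ (T : α → Fin n) (b : α → ℚ) (cs : List α) (μ ν : YoungDiagram) :
    ∑ L ∈ chF μ ν, QQ T (fun μ c => (kv n μ (T c) : ℚ) - b c) cs L =
      proc (cs.map fun c => (T c, b c)) (ind ν) μ := by
  classical
  induction cs generalizing μ with
  | nil =>
    simp only [QQ, List.map_nil, proc]
    by_cases h : μ = ν
    · subst h
      rw [ind_self, Finset.sum_eq_single [μ]]
      · rfl
      · intro L hL hne
        rw [if_neg]
        intro hlen
        obtain ⟨a, rfl⟩ := List.length_eq_one_iff.1 hlen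
        have := (mem_chF.1 hL).2.1
        simp at this
        exact hne (by rw [this])
      · intro h
        exact absurd (mem_chF.2 ⟨List.isChain_singleton _, by simp, by simp⟩) h
    · rw [ind_ne h]
      apply Finset.sum_eq_zero
      intro L hL
      rw [if_neg]
      intro hlen
      obtain ⟨a, rfl⟩ := List.length_eq_one_iff.1 hlen
      have h1 := (mem_chF.1 hL).2.1
      have h2 := (mem_chF.1 hL).2.2
      simp at h1 h2
      exact h (h1.symm.trans h2)
  | cons c cs ih =>
    rw [List.map_cons, proc, ← ih μ, Finset.mul_sum]
    have h1 : ∀ L ∈ chF μ ν, QQ T (fun μ c => (kv n μ (T c) : ℚ) - b c) (c :: cs) L =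
        ((kv n μ (T c) : ℚ) - b c) * QQ T (fun μ c => (kv n μ (T c) : ℚ) - b c) cs L +
        if ∃ τ L', L = μ :: τ :: L' ∧ (T c : ℕ) = stepRow μ τ then
          QQ T (fun μ c => (kv n μ (T c) : ℚ) - b c) cs L.tail else 0 := by
      intro L hL
      have hL := mem_chF.1 hL
      rcases L with _ | ⟨a, _ | ⟨τ, L⟩⟩
      · simp [chainSet] at hL
      · have := hL.2.1
        simp at this; subst this
        rw [if_neg (by simp), add_zero, QQ]
      · have h2 := hL.2.1
        simp only [List.head?_cons, Option.some.injEq] at h2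
        subst h2
        rw [QQ]
        simp
    rw [Finset.sum_congr rfl h1, Finset.sum_add_distrib]
    congr 1
    rw [← Finset.sum_filter]
    split_ifs with hA
    · rw [← ih]
      refine Finset.sum_bij' (fun L _ => L.tail) (fun L _ => μ :: L) ?_ ?_ ?_ ?_ ?_
      · intro L hL
        rw [Finset.mem_filter, mem_chF] at hL
        obtain ⟨hL, τ, L', rfl, hs⟩ := hL
        obtain ⟨h2, h3⟩ := chain_cons.1 hL
        have h4 := (covers_stepRow_iff.1 ⟨h2, hs.symm⟩).2
        subst h4
        exact mem_chF.2 h3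
      · intro L hL
        rw [Finset.mem_filter, mem_chF]
        have hL := mem_chF.1 hL
        rcases L with _ | ⟨a, L⟩
        · simp [chainSet] at hL
        have h2 := hL.2.1
        simp only [List.head?_cons, Option.some.injEq] at h2
        subst h2
        have := covers_stepRow_iff.2 ⟨hA, rfl⟩
        exact ⟨chain_cons.2 ⟨this.1, hL⟩, _, _, rfl, this.2.symm⟩
      · intro L hL
        rw [Finset.mem_filter, mem_chF] at hL
        obtain ⟨hL, τ, L', rfl, hs⟩ := hL
        rfl
      · intro L hL; rfl
      · intro L hL; rfl
    · apply Finset.sum_eq_zero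
      intro L hL
      rw [Finset.mem_filter, mem_chF] at hL
      obtain ⟨hL, τ, L', rfl, hs⟩ := hL
      obtain ⟨h2, h3⟩ := chain_cons.1 hL
      exact absurd (covers_stepRow_iff.1 ⟨h2, hs.symm⟩).1 hA

end chains

section bars
variable {α : Type*} {n : ℕ}

open Classical in
/-- admissible barrings with values in the list `cs` -/
noncomputable def bars [Fintype α] (lt : α → α → Prop) (T : α → Fin n) (cs : List α)
    (L : List YoungDiagram) (m : ℕ) : Finset (Fin m → α) :=
  Finset.univ.filter fun β => (∀ i, β i ∈ cs) ∧ (∀ i j, i < j → lt (β i) (β j)) ∧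
    ∀ i : Fin m, (T (β i) : ℕ) = stepRow (L.getD (i : ℕ) ⊥) (L.getD ((i : ℕ) + 1) ⊥)

open Classical in
noncomputable def bfac (lt : α → α → Prop) (wt : YoungDiagram → α → ℚ)
    (L : List YoungDiagram) {m : ℕ} (β : Fin m → α) (c : α) : ℚ :=
  if ∃ i, β i = c then 1 else wt (L.getD (Finset.univ.filter (fun i => lt (β i) c)).card ⊥) c

lemma sum_bars [Fintype α] (lt : α → α → Prop) (hirr : ∀ a b, lt a b → ¬ lt b a)
    (T : α → Fin n) (wt : YoungDiagram → α → ℚ) (cs : List α) (hcs : cs.Pairwise lt)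
    (L : List YoungDiagram) (m : ℕ) (hL : L.length = m + 1) :
    ∑ β ∈ bars lt T cs L m, (cs.map (bfac lt wt L β)).prod = QQ T wt cs L := by
  classical
  have hirr' : ∀ a, ¬ lt a a := fun a h => hirr a a h h
  induction cs generalizing L m with
  | nil =>
    simp only [List.map_nil, List.prod_nil, Finset.sum_const, nsmul_eq_mul, mul_one, QQ, hL]
    cases m with
    | zero =>
      have : bars lt T [] L 0 = Finset.univ := by
        apply Finset.filter_true_of_mem
        intro β _
        exact ⟨fun i => i.elim0, fun i => i.elim0, fun i => i.elim0⟩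
      rw [this]; simp
    | succ m =>
      have : bars lt T [] L (m + 1) = ∅ := by
        apply Finset.filter_false_of_mem
        intro β _ h
        exact absurd (h.1 0) (by simp)
      rw [this]; simp
  | cons c cs ih =>
    rw [List.pairwise_cons] at hcs
    have hc : c ∉ cs := fun h => hirr' c (hcs.1 c h)
    obtain ⟨μ, L', rfl⟩ : ∃ μ L', L = μ :: L' := by
      cases L with
      | nil => simp at hL
      | cons a L => exact ⟨a, L, rfl⟩
    rw [← Finset.sum_filter_add_sum_filter_not _ (fun β => ¬ ∃ i, β i = c)]
    have h1 : (bars lt T (c :: cs) (μ :: L') m).filter (fun β => ¬ ∃ i, β i = c) =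
        bars lt T cs (μ :: L') m := by
      ext β
      simp only [bars, Finset.mem_filter, Finset.mem_univ, true_and]
      constructor
      · rintro ⟨⟨h1, h2, h3⟩, h4⟩
        refine ⟨fun i => ?_, h2, h3⟩
        rcases List.mem_cons.1 (h1 i) with h | h
        · exact absurd ⟨i, h⟩ h4
        · exact h
      · rintro ⟨h1, h2, h3⟩
        refine ⟨⟨fun i => List.mem_cons_of_mem _ (h1 i), h2, h3⟩, ?_⟩
        rintro ⟨i, hi⟩
        exact hc (hi ▸ h1 i)
    have h2 : ∑ β ∈ (bars lt T (c :: cs) (μ :: L') m).filter (fun β => ¬ ∃ i, β i = c),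
        ((c :: cs).map (bfac lt wt (μ :: L') β)).prod = wt μ c * QQ T wt cs (μ :: L') := by
      rw [h1, ← ih hcs.2 (μ :: L') m hL, Finset.mul_sum]
      refine Finset.sum_congr rfl fun β hβ => ?_
      rw [List.map_cons, List.prod_cons]
      congr 1
      simp only [bars, Finset.mem_filter, Finset.mem_univ, true_and] at hβ
      unfold bfac
      rw [if_neg, Finset.filter_false_of_mem]
      · simp
      · intro i _ hlt
        exact hirr _ _ hlt (hcs.1 _ (hβ.1 i))
      · rintro ⟨i, hi⟩
        exact hc (hi ▸ hβ.1 i)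
    rw [h2]
    cases m with
    | zero =>
      have h3 : L' = [] := by simpa using hL
      subst h3
      rw [QQ, Finset.sum_eq_zero, add_zero]
      intro β hβ
      simp at hβ
    | succ m =>
      obtain ⟨τ, L', rfl⟩ : ∃ τ L'', L' = τ :: L'' := by
        cases L' with
        | nil => simp at hL
        | cons a L => exact ⟨a, L, rfl⟩
      rw [QQ]
      congr 1
      have hmem : ∀ β ∈ (bars lt T (c :: cs) (μ :: τ :: L') (m + 1)).filter
          (fun β => ¬ ¬ ∃ i, β i = c), β 0 = c ∧ (∀ i : Fin m, β i.succ ∈ cs) := by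
        intro β hβ
        simp only [bars, Finset.mem_filter, Finset.mem_univ, true_and, not_not] at hβ
        obtain ⟨⟨h1, h2, h3⟩, i, hi⟩ := hβ
        have h0 : β 0 = c := by
          rcases Fin.eq_zero_or_eq_succ i with rfl | ⟨k, rfl⟩
          · exact hi
          · exfalso
            have h4 := h2 0 k.succ (Fin.succ_pos k)
            rw [hi] at h4
            rcases List.mem_cons.1 (h1 0) with h | h
            · rw [h] at h4; exact hirr' _ h4
            · exact hirr _ _ h4 (hcs.1 _ h)
        refine ⟨h0, fun k => ?_⟩
        rcases List.mem_cons.1 (h1 k.succ) with h | h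
        · have h4 := h2 0 k.succ (Fin.succ_pos k)
          rw [h0, h] at h4
          exact absurd h4 (hirr' _)
        · exact h
      split_ifs with hs
      · rw [← ih hcs.2 (τ :: L') m (by simpa using hL)]
        refine Finset.sum_bij' (fun β _ => fun i => β i.succ) (fun β _ => Fin.cons c β) ?_ ?_ ?_ ?_ ?_
        · intro β hβ
          have h4 := hmem β hβ
          simp only [bars, Finset.mem_filter, Finset.mem_univ, true_and, not_not] at hβ ⊢
          refine ⟨h4.2, fun i j hij => hβ.1.2.1 _ _ (Fin.succ_lt_succ_iff.2 hij), fun i => ?_⟩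
          have := hβ.1.2.2 i.succ
          simpa using this
        · intro β hβ
          simp only [bars, Finset.mem_filter, Finset.mem_univ, true_and, not_not] at hβ ⊢
          refine ⟨⟨fun i => ?_, fun i j hij => ?_, fun i => ?_⟩, 0, rfl⟩
          · refine Fin.cases ?_ (fun k => ?_) i
            · simp
            · simp [hβ.1 k]
          · revert hij
            refine Fin.cases ?_ (fun k => ?_) j
            · intro h; exact absurd h (Fin.not_lt_zero i)
            · refine Fin.cases ?_ (fun l => ?_) i
              · intro _; simp only [Fin.cons_zero, Fin.cons_succ]; exact hcs.1 _ (hβ.1 k)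
              · intro h; simp only [Fin.cons_succ]; exact hβ.2.1 _ _ (Fin.succ_lt_succ_iff.1 h)
          · refine Fin.cases ?_ (fun k => ?_) i
            · simpa using hs
            · simpa using hβ.2.2 k
        · intro β hβ
          have h4 := hmem β hβ
          funext i
          refine Fin.cases ?_ (fun k => ?_) i
          · simp [h4.1]
          · simp
        · intro β hβ
          funext i; simp
        · intro β hβ
          have h4 := hmem β hβ
          rw [List.map_cons, List.prod_cons]
          have h5 : bfac lt wt (μ :: τ :: L') β c = 1 := by
            unfold bfac; rw [if_pos ⟨0, h4.1⟩]
          rw [h5, one_mul]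
          congr 1
          apply List.map_congr_left
          intro d hd
          have hdc : c ≠ d := by rintro rfl; exact hc hd
          unfold bfac
          have h6 : (∃ i, β i = d) ↔ ∃ i : Fin m, β i.succ = d := by
            constructor
            · rintro ⟨i, hi⟩
              rcases Fin.eq_zero_or_eq_succ i with rfl | ⟨k, rfl⟩
              · exact absurd (h4.1.symm.trans hi) hdc
              · exact ⟨k, hi⟩
            · rintro ⟨i, hi⟩; exact ⟨_, hi⟩
          have h7 : (Finset.univ.filter (fun i => lt (β i) d)).card =
              (Finset.univ.filter (fun i : Fin m => lt (β i.succ) d)).card + 1 := by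
            rw [Fin.card_filter_univ_succ, if_pos]
            rw [h4.1]; exact hcs.1 d hd
          rw [h7]
          simp only [h6, List.getD_cons_succ]
      · apply Finset.sum_eq_zero
        intro β hβ
        exfalso
        have h4 := hmem β hβ
        simp only [bars, Finset.mem_filter, Finset.mem_univ, true_and, not_not] at hβ
        have := hβ.1.2.2 0
        rw [h4.1] at this
        exact hs (by simpa using this)

end bars
end FactorialLR

namespace FactorialLR

section cells

/-- cells of the first `j` columns in column order -/
def cl (h : ℕ → ℕ) : ℕ → List (ℕ × ℕ)
  | 0 => []
  | j + 1 => (List.range (h j)).map (fun i => (i, j)) ++ cl h j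

lemma mem_cl {h : ℕ → ℕ} {j : ℕ} {c : ℕ × ℕ} : c ∈ cl h j ↔ c.2 < j ∧ c.1 < h c.2 := by
  induction j with
  | zero => simp [cl]
  | succ j ih =>
    obtain ⟨a, b⟩ := c
    simp only [cl, List.mem_append, ih, List.mem_map, List.mem_range, Prod.mk.injEq]
    constructor
    · rintro (⟨i, hi, rfl, rfl⟩ | h)
      · exact ⟨by simp, hi⟩
      · exact ⟨by omega, h.2⟩
    · rintro ⟨h1, h2⟩
      by_cases hb : b = j
      · subst hb; exact Or.inl ⟨a, h2, rfl, rfl⟩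
      · exact Or.inr ⟨by omega, h2⟩

lemma cl_pairwise (h : ℕ → ℕ) (j : ℕ) : (cl h j).Pairwise ColLT := by
  induction j with
  | zero => simp [cl]
  | succ j ih =>
    rw [cl, List.pairwise_append]
    refine ⟨?_, ih, ?_⟩
    · rw [List.pairwise_map]
      exact List.pairwise_lt_range.imp (fun hab => Or.inr ⟨rfl, hab⟩)
    · intro a ha b hb
      rw [List.mem_map] at ha
      obtain ⟨i, -, rfl⟩ := ha
      exact Or.inl (mem_cl.1 hb).1

lemma mem_cl_lam {lam : YoungDiagram} {c : ℕ × ℕ} :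
    c ∈ cl lam.colLen (lam.rowLen 0) ↔ c ∈ lam.cells := by
  obtain ⟨a, b⟩ := c
  rw [mem_cl, YoungDiagram.mem_cells, YoungDiagram.mem_iff_lt_colLen]
  constructor
  · exact fun h => h.2
  · intro h
    refine ⟨?_, h⟩
    have h1 := (lt_row_iff lam a b).2 h
    exact h1.trans_le (lam.rowLen_anti 0 a (Nat.zero_le _))

def cellList (lam : YoungDiagram) : List lam.cells :=
  (cl lam.colLen (lam.rowLen 0)).pmap Subtype.mk (fun _ h => mem_cl_lam.1 h)

lemma map_cellList (lam : YoungDiagram) :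
    (cellList lam).map Subtype.val = cl lam.colLen (lam.rowLen 0) := by
  unfold cellList
  rw [List.map_pmap]
  simp

lemma mem_cellList (lam : YoungDiagram) (c : lam.cells) : c ∈ cellList lam := by
  unfold cellList
  rw [List.mem_pmap]
  exact ⟨c, mem_cl_lam.2 c.2, rfl⟩

lemma cellList_pairwise (lam : YoungDiagram) :
    (cellList lam).Pairwise (fun a b : lam.cells => ColLT (a : ℕ × ℕ) b) := by
  have := cl_pairwise lam.colLen (lam.rowLen 0)
  rw [← map_cellList, List.pairwise_map] at this
  exact this

lemma colLT_asymm (a b : ℕ × ℕ) (h : ColLT a b) : ¬ ColLT b a := by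
  unfold ColLT at *; omega

def bc {n : ℕ} {lam : YoungDiagram} (T : lam.cells → Fin n) (c : lam.cells) : ℚ :=
  ((T c : ℕ) : ℚ) + ((c : ℕ × ℕ).2 : ℚ) - ((c : ℕ × ℕ).1 : ℚ)

open Classical in
theorem fcoef_eq_sum (n : ℕ) (lam μ ν : YoungDiagram) :
    (fcoef n lam μ ν : ℚ) = ∑ T ∈ Finset.univ.filter (fun T : lam.cells → Fin n => IsSsyt lam.cells T),
      proc ((cellList lam).map fun c => (T c, bc T c)) (ind ν) μ := by
  unfold fcoef
  rw [finsum_mem_eq_finite_toFinset_sum _ (chain_finite μ ν)]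
  change ((∑ L ∈ chF μ ν, _ : ℤ) : ℚ) = _
  rw [Int.cast_sum]
  simp only [← sum_QQ]
  rw [Finset.sum_comm]
  refine Finset.sum_congr rfl fun L hL => ?_
  rw [finsum_mem_eq_finite_toFinset_sum _ (Set.toFinite _), Int.cast_sum]
  have hlen : L.length = (L.length - 1) + 1 := by
    have := (mem_chF.1 hL).2.1
    cases L with
    | nil => simp at this
    | cons a L => simp
  rw [Finset.sum_finset_product _
    (Finset.univ.filter (fun T : lam.cells → Fin n => IsSsyt lam.cells T))
    (fun T => bars (fun a b : lam.cells => ColLT (a : ℕ × ℕ) b) T (cellList lam) L (L.length - 1))]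
  · refine Finset.sum_congr rfl fun T _ => ?_
    rw [← sum_bars (fun a b : lam.cells => ColLT (a : ℕ × ℕ) b) (fun a b => colLT_asymm a b) T _
      (cellList lam) (cellList_pairwise lam) L (L.length - 1) hlen]
    refine Finset.sum_congr rfl fun β _ => ?_
    rw [Int.cast_prod]
    have hnd : (cellList lam).Nodup := (cellList_pairwise lam).imp (fun {a b} hab h => by
      subst h; exact colLT_asymm _ _ hab hab)
    rw [← List.prod_toFinset _ hnd]
    have hu : (cellList lam).toFinset = Finset.univ := by
      ext c; simp [mem_cellList]
    rw [hu]
    refine Finset.prod_congr rfl fun c _ => ?_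
    unfold bfac
    by_cases hb : ∃ i, β i = c
    · rw [if_pos hb, if_pos hb]; simp
    · rw [if_neg hb, if_neg hb]
      unfold rhoOf bc kv
      have h1 := (T c).2
      push_cast
      rw [Nat.cast_sub (by omega), Nat.cast_sub (by omega)]
      have h2 : ∀ (i j : ℕ) (hij : i = j), ((L.getD i ⊥).rowLen (T c) : ℚ) = (L.getD j ⊥).rowLen (T c) := by
        rintro i _ rfl; rfl
      rw [h2 _ (Finset.univ.filter (fun i => ColLT (β i : ℕ × ℕ) (c : ℕ × ℕ))).card
        (by congr)]
      push_cast
      ring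
  · rintro ⟨T, β⟩
    simp only [Set.Finite.mem_toFinset, TSet, bars, Finset.mem_filter, Finset.mem_univ, true_and]
    constructor
    · rintro ⟨h1, h2, h3⟩
      exact ⟨h1, fun i => mem_cellList _ _, h2, h3⟩
    · rintro ⟨h1, -, h2, h3⟩
      exact ⟨h1, h2, h3⟩

end cells

section families
variable {n : ℕ}

def valid (h : ℕ → ℕ) : ℕ → (ℕ → Finset (Fin n)) → Finset (Fin n) → Prop
  | 0, _, _ => True
  | j + 1, C, γ => (C j).card = h j ∧ Dom (C j) γ ∧ valid h j C (C j)

def lst : ℕ → (ℕ → Finset (Fin n)) → List (Fin n × ℚ)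
  | 0, _ => []
  | j + 1, C => colList j (C j) ++ lst j C

lemma valid_congr (h : ℕ → ℕ) (j : ℕ) (C C' : ℕ → Finset (Fin n)) (γ : Finset (Fin n))
    (hC : ∀ i < j, C i = C' i) : valid h j C γ ↔ valid h j C' γ := by
  induction j generalizing γ with
  | zero => rfl
  | succ j ih =>
    rw [valid, valid, hC j (by omega), ih _ (fun i hi => hC i (by omega))]

lemma lst_congr (j : ℕ) (C C' : ℕ → Finset (Fin n))
    (hC : ∀ i < j, C i = C' i) : lst j C = lst j C' := by
  induction j with
  | zero => rfl
  | succ j ih =>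
    rw [lst, lst, hC j (by omega), ih (fun i hi => hC i (by omega))]

lemma valid_iff (h : ℕ → ℕ) (j : ℕ) (C : ℕ → Finset (Fin n)) (γ : Finset (Fin n)) :
    valid h j C γ ↔ (∀ i < j, (C i).card = h i) ∧ (∀ i, i + 1 < j → Dom (C i) (C (i + 1))) ∧
      (∀ i, i + 1 = j → Dom (C i) γ) := by
  induction j generalizing γ with
  | zero => simp [valid]
  | succ j ih =>
    rw [valid, ih]
    constructor
    · rintro ⟨h1, h2, h3, h4, h5⟩
      refine ⟨fun i hi => ?_, fun i hi => ?_, fun i hi => ?_⟩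
      · rcases Nat.lt_succ_iff_lt_or_eq.1 hi with hi | rfl
        · exact h3 i hi
        · exact h1
      · rcases Nat.lt_succ_iff_lt_or_eq.1 hi with hi | hi
        · exact h4 i hi
        · subst hi; exact h5 i rfl
      · have : i = j := by omega
        subst this; exact h2
    · rintro ⟨h1, h2, h3⟩
      exact ⟨h1 j (by omega), h3 j rfl, fun i hi => h1 i (by omega), fun i hi => h2 i (by omega),
        fun i hi => by subst hi; exact h2 i (by omega)⟩

/-- extension of a finite family by empty sets -/
def ex {J : ℕ} (C : Fin J → Finset (Fin n)) : ℕ → Finset (Fin n) :=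
  fun j => if h : j < J then C ⟨j, h⟩ else ∅

open Classical in
lemma V_unroll (h : ℕ → ℕ) (c : YoungDiagram → ℚ) (J : ℕ) (γ : Finset (Fin n)) (μ : YoungDiagram) :
    V h c J γ μ = ∑ C : Fin J → Finset (Fin n),
      (if valid h J (ex C) γ then 1 else 0) * proc (lst J (ex C)) c μ := by
  induction J generalizing γ μ with
  | zero => simp [V, valid, lst, proc]
  | succ J ih =>
    rw [V]; beta_reduce
    rw [← (Fin.snocEquiv (fun _ : Fin (J + 1) => Finset (Fin n))).sum_comp, Fintype.sum_prod_type,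
      Finset.sum_filter]
    refine Finset.sum_congr rfl fun δ _ => ?_
    have hex : ∀ C : Fin J → Finset (Fin n), ∀ i < J,
        ex ((Fin.snocEquiv (fun _ : Fin (J + 1) => Finset (Fin n))) (δ, C)) i = ex C i := by
      intro C i hi
      unfold ex
      rw [dif_pos (by omega), dif_pos hi]
      simp only [Fin.snocEquiv_apply]
      exact Fin.snoc_castSucc (α := fun _ => Finset (Fin n)) δ C ⟨i, hi⟩
    have hex2 : ∀ C : Fin J → Finset (Fin n),
        ex ((Fin.snocEquiv (fun _ : Fin (J + 1) => Finset (Fin n))) (δ, C)) J = δ := by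
      intro C
      unfold ex
      rw [dif_pos (by omega)]
      simp only [Fin.snocEquiv_apply]
      exact Fin.snoc_last (α := fun _ => Finset (Fin n)) δ C
    simp only [valid, lst, hex2]
    have h1 : ∀ C : Fin J → Finset (Fin n),
        (valid h J (ex ((Fin.snocEquiv (fun _ : Fin (J + 1) => Finset (Fin n))) (δ, C))) δ ↔
          valid h J (ex C) δ) := fun C => valid_congr _ _ _ _ _ (hex C)
    have h2 : ∀ C : Fin J → Finset (Fin n),
        lst J (ex ((Fin.snocEquiv (fun _ : Fin (J + 1) => Finset (Fin n))) (δ, C))) =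
          lst J (ex C) := fun C => lst_congr _ _ _ (hex C)
    simp only [h1, h2, proc_append]
    by_cases hv : δ.card = h J ∧ Dom δ γ
    · rw [if_pos hv]
      rw [show V h c J δ = fun κ => ∑ C : Fin J → Finset (Fin n),
        (if valid h J (ex C) δ then 1 else 0) * proc (lst J (ex C)) c κ from funext fun κ => ih δ κ,
        proc_sum]
      simp only [hv, true_and]
    · rw [if_neg hv]
      symm
      apply Finset.sum_eq_zero
      intro C _
      rw [if_neg (fun h => hv ⟨h.1, h.2.1⟩), zero_mul]

lemma card_filter_image {m : ℕ} {F : ℕ → Fin n} (hF : ∀ a b, a < b → b < m → F a < F b)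
    (P : Fin n → Prop) [DecidablePred P] :
    (((Finset.range m).image F).filter P).card = ((Finset.range m).filter (fun i => P (F i))).card := by
  rw [Finset.filter_image, Finset.card_image_of_injOn]
  intro a ha b hb hab
  simp only [Finset.coe_filter, Finset.mem_range, Set.mem_ofPred_eq] at ha hb
  rcases lt_trichotomy a b with h | h | h
  · exact absurd hab (hF a b h hb.1).ne
  · exact h
  · exact absurd hab (hF b a h ha.1).ne'

lemma strict_lt_iff {m : ℕ} {F : ℕ → Fin n} (hF : ∀ a b, a < b → b < m → F a < F b) {a b : ℕ}
    (ha : a < m) (hb : b < m) : F a < F b ↔ a < b := by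
  constructor
  · intro h
    by_contra hc
    rcases (not_lt.1 hc).eq_or_lt with h1 | h1
    · subst h1; exact lt_irrefl _ h
    · exact lt_asymm h (hF b a h1 ha)
  · exact fun h => hF a b h hb

lemma strict_le_iff {m : ℕ} {F : ℕ → Fin n} (hF : ∀ a b, a < b → b < m → F a < F b) {a b : ℕ}
    (ha : a < m) (hb : b < m) : F a ≤ F b ↔ a ≤ b := by
  rw [← not_lt, strict_lt_iff hF hb ha, not_lt]

lemma pos_image {m : ℕ} {F : ℕ → Fin n} (hF : ∀ a b, a < b → b < m → F a < F b) {i : ℕ} (hi : i < m) :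
    pos ((Finset.range m).image F) (F i) = i := by
  unfold pos
  rw [card_filter_image hF]
  have : (Finset.range m).filter (fun k => F k < F i) = Finset.range i := by
    ext k
    simp only [Finset.mem_filter, Finset.mem_range]
    constructor
    · rintro ⟨h1, h2⟩; exact (strict_lt_iff hF h1 hi).1 h2
    · intro h; exact ⟨by omega, hF k i h hi⟩
  rw [this, Finset.card_range]

lemma card_image_strict {m : ℕ} {F : ℕ → Fin n} (hF : ∀ a b, a < b → b < m → F a < F b) :
    ((Finset.range m).image F).card = m := by
  have := card_filter_image hF (fun _ => True)
  simpa using this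

lemma sort_image {m : ℕ} {F : ℕ → Fin n} (hF : ∀ a b, a < b → b < m → F a < F b) :
    ((Finset.range m).image F).sort (· ≤ ·) = (List.range m).map F := by
  have hp : ((List.range m).map F).Pairwise (· < ·) := by
    rw [List.pairwise_map]
    apply List.Pairwise.imp_of_mem _ (List.pairwise_lt_range (n := m))
    intro a b _ hb hab
    exact hF a b hab (List.mem_range.1 hb)
  have h1 : (Finset.range m).image F = ((List.range m).map F).toFinset := by
    ext v; simp
  rw [h1]
  exact (List.toFinset_sort (· ≤ ·) (hp.imp (fun h => h.ne))).2 (hp.imp (fun h => h.le))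

lemma colList_image {m : ℕ} {F : ℕ → Fin n} (hF : ∀ a b, a < b → b < m → F a < F b) (j : ℕ) :
    colList j ((Finset.range m).image F) =
      (List.range m).map (fun i => (F i, ((F i : ℕ) : ℚ) + (j : ℚ) - (i : ℚ))) := by
  unfold colList
  rw [sort_image hF, List.map_map]
  apply List.map_congr_left
  intro i hi
  simp only [Function.comp, bw, pos_image hF (List.mem_range.1 hi)]

lemma dom_image {m m' : ℕ} {F G : ℕ → Fin n} (hF : ∀ a b, a < b → b < m → F a < F b)
    (hG : ∀ a b, a < b → b < m' → G a < G b) (hm : m' ≤ m) :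
    Dom ((Finset.range m).image F) ((Finset.range m').image G) ↔ ∀ i < m', F i ≤ G i := by
  unfold Dom
  constructor
  · intro h i hi
    have h1 := h (G i)
    rw [card_filter_image hF, card_filter_image hG] at h1
    have h2 : Finset.range (i + 1) ⊆ (Finset.range m').filter (fun k => G k ≤ G i) := by
      intro k hk
      rw [Finset.mem_range] at hk
      rw [Finset.mem_filter, Finset.mem_range]
      exact ⟨by omega, (strict_le_iff hG (by omega) hi).2 (by omega)⟩
    have h3 := (Finset.card_le_card h2).trans h1
    rw [Finset.card_range] at h3
    by_contra hc
    have h4 : (Finset.range m).filter (fun k => F k ≤ G i) ⊆ Finset.range i := by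
      intro k hk
      rw [Finset.mem_filter, Finset.mem_range] at hk
      rw [Finset.mem_range]
      by_contra hki
      apply hc
      exact ((strict_le_iff hF (by omega) hk.1).2 (by omega)).trans hk.2
    have := Finset.card_le_card h4
    rw [Finset.card_range] at this
    omega
  · intro h v
    rw [card_filter_image hF, card_filter_image hG]
    apply Finset.card_le_card
    intro k hk
    rw [Finset.mem_filter, Finset.mem_range] at hk ⊢
    exact ⟨by omega, (h k hk.1).trans hk.2⟩

end families
end FactorialLR

namespace FactorialLR

section bij
variable {n : ℕ}

def tot (hn : 0 < n) {lam : YoungDiagram} (T : lam.cells → Fin n) (c : ℕ × ℕ) : Fin n :=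
  if h : c ∈ lam.cells then T ⟨c, h⟩ else ⟨0, hn⟩

lemma tot_mem (hn : 0 < n) {lam : YoungDiagram} (T : lam.cells → Fin n) (c : lam.cells) :
    tot hn T c = T c := by
  unfold tot; rw [dif_pos c.2]

def colF (hn : 0 < n) {lam : YoungDiagram} (T : lam.cells → Fin n) (j : ℕ) : Finset (Fin n) :=
  (Finset.range (lam.colLen j)).image (fun i => tot hn T (i, j))

lemma mem_lam {lam : YoungDiagram} {i j : ℕ} (h : i < lam.colLen j) : (i, j) ∈ lam.cells :=
  (YoungDiagram.mem_cells _).2 (YoungDiagram.mem_iff_lt_colLen.2 h)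

lemma tot_strict (hn : 0 < n) {lam : YoungDiagram} {T : lam.cells → Fin n}
    (hT : IsSsyt lam.cells T) (j a b : ℕ) (hab : a < b) (hb : b < lam.colLen j) :
    tot hn T (a, j) < tot hn T (b, j) := by
  have h1 := tot_mem hn T ⟨(a, j), mem_lam (hab.trans hb)⟩
  have h2 := tot_mem hn T ⟨(b, j), mem_lam hb⟩
  simp only at h1 h2
  rw [h1, h2]
  exact hT.2 _ _ hab rfl

lemma lst_col (hn : 0 < n) {lam : YoungDiagram} {T : lam.cells → Fin n}
    (hT : IsSsyt lam.cells T) (j : ℕ) :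
    lst j (colF hn T) = (cl lam.colLen j).map (fun c => (tot hn T c,
      ((tot hn T c : ℕ) : ℚ) + (c.2 : ℚ) - (c.1 : ℚ))) := by
  induction j with
  | zero => rfl
  | succ j ih =>
    rw [lst, cl, List.map_append, ih, List.map_map]
    congr 1
    unfold colF
    rw [colList_image (tot_strict hn hT j)]
    rfl

lemma ex_val {J : ℕ} (D : ℕ → Finset (Fin n)) {i : ℕ} (hi : i < J) :
    ex (fun j : Fin J => D j) i = D i := by
  unfold ex; rw [dif_pos hi]

lemma list_eq (hn : 0 < n) {lam : YoungDiagram} {T : lam.cells → Fin n}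
    (hT : IsSsyt lam.cells T) :
    (cellList lam).map (fun c => (T c, bc T c)) =
      lst (lam.rowLen 0) (ex (fun j : Fin (lam.rowLen 0) => colF hn T j)) := by
  rw [lst_congr _ _ (colF hn T) (fun i hi => ex_val _ hi), lst_col hn hT, ← map_cellList,
    List.map_map]
  apply List.map_congr_left
  intro c _
  simp only [Function.comp, tot_mem, bc]

theorem sum_ssyt (hn : 0 < n) (lam μ ν : YoungDiagram) :
    open Classical in
    ∑ T ∈ Finset.univ.filter (fun T : lam.cells → Fin n => IsSsyt lam.cells T),
      proc ((cellList lam).map fun c => (T c, bc T c)) (ind ν) μ = fV n lam ν μ := by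
  classical
  unfold fV
  rw [V_unroll]
  simp only [ite_mul, one_mul, zero_mul]
  rw [← Finset.sum_filter]
  refine Finset.sum_bij (fun T _ => fun j : Fin (lam.rowLen 0) => colF hn T j) ?_ ?_ ?_ ?_
  · intro T hT
    have hT := (Finset.mem_filter.1 hT).2
    rw [Finset.mem_filter]
    refine ⟨Finset.mem_univ _, ?_⟩
    rw [valid_congr _ _ _ (colF hn T) _ (fun i hi => ex_val _ hi), valid_iff]
    refine ⟨fun i _ => card_image_strict (tot_strict hn hT i), fun j _ => ?_, fun j _ v => by simp⟩
    have hle : lam.colLen (j + 1) ≤ lam.colLen j := lam.colLen_anti j (j + 1) (by omega)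
    unfold colF
    rw [dom_image (tot_strict hn hT j) (tot_strict hn hT (j + 1)) hle]
    intro i hi
    have h1 := tot_mem hn T ⟨(i, j), mem_lam (hi.trans_le hle)⟩
    have h2 := tot_mem hn T ⟨(i, j + 1), mem_lam hi⟩
    simp only at h1 h2
    rw [h1, h2]
    exact hT.1 _ _ rfl (by simp)
  · intro T hT T' hT' heq
    have hT := (Finset.mem_filter.1 hT).2
    have hT' := (Finset.mem_filter.1 hT').2
    funext c
    obtain ⟨⟨i, j⟩, hc⟩ := c
    have hi : i < lam.colLen j :=
      YoungDiagram.mem_iff_lt_colLen.1 ((YoungDiagram.mem_cells _).1 hc)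
    have hj : j < lam.rowLen 0 := (mem_cl.1 (mem_cl_lam.2 hc)).1
    have h1 : colF hn T j = colF hn T' j := congrFun heq ⟨j, hj⟩
    unfold colF at h1
    have h2 := sort_image (tot_strict hn hT j)
    rw [h1, sort_image (tot_strict hn hT' j)] at h2
    have h3 := List.map_inj_left.1 h2 i (List.mem_range.2 hi)
    rw [← tot_mem hn T, ← tot_mem hn T']
    exact h3.symm
  · intro C hC
    have hC := (Finset.mem_filter.1 hC).2
    rw [valid_iff] at hC
    obtain ⟨h1, h2, -⟩ := hC
    let G : ℕ → ℕ → Fin n := fun j i =>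
      if h : j < lam.rowLen 0 ∧ i < lam.colLen j then
        (ex C j).orderEmbOfFin (h1 j h.1) ⟨i, h.2⟩ else ⟨0, hn⟩
    have hG : ∀ j (hj : j < lam.rowLen 0) i (hi : i < lam.colLen j),
        G j i = (ex C j).orderEmbOfFin (h1 j hj) ⟨i, hi⟩ := by
      intro j hj i hi
      simp only [G]
      rw [dif_pos ⟨hj, hi⟩]
    have hstr : ∀ j, j < lam.rowLen 0 → ∀ a b, a < b → b < lam.colLen j → G j a < G j b := by
      intro j hj a b hab hb
      rw [hG j hj a (hab.trans hb), hG j hj b hb]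
      exact (OrderEmbedding.lt_iff_lt _).2 hab
    have himg : ∀ j, j < lam.rowLen 0 → (Finset.range (lam.colLen j)).image (G j) = ex C j := by
      intro j hj
      apply Finset.eq_of_subset_of_card_le
      · intro v hv
        rw [Finset.mem_image] at hv
        obtain ⟨i, hi, rfl⟩ := hv
        rw [hG j hj i (Finset.mem_range.1 hi)]
        exact Finset.orderEmbOfFin_mem _ _ _
      · rw [card_image_strict (hstr j hj), h1 j hj]
    have hrow : ∀ i j k, j + k < lam.rowLen 0 → i < lam.colLen (j + k) → G j i ≤ G (j + k) i := by
      intro i j k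
      induction k with
      | zero => intro _ _; exact le_rfl
      | succ k ih =>
        intro hk hi
        have hle : lam.colLen (j + k + 1) ≤ lam.colLen (j + k) :=
          lam.colLen_anti (j + k) (j + k + 1) (by omega)
        have hk' : j + k + 1 < lam.rowLen 0 := by omega
        have hi' : i < lam.colLen (j + k + 1) := hi
        have h3 := h2 (j + k) hk'
        rw [← himg (j + k) (by omega), ← himg (j + k + 1) hk',
          dom_image (hstr _ (by omega)) (hstr _ hk') hle] at h3
        exact (ih (by omega) (by omega)).trans (h3 i hi')
    have hcell : ∀ c : lam.cells, (c : ℕ × ℕ).2 < lam.rowLen 0 ∧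
        (c : ℕ × ℕ).1 < lam.colLen (c : ℕ × ℕ).2 := fun c => mem_cl.1 (mem_cl_lam.2 c.2)
    have hss : IsSsyt lam.cells (fun c => G (c : ℕ × ℕ).2 (c : ℕ × ℕ).1) := by
      constructor
      · rintro c c' hcc hle
        obtain ⟨k, hk⟩ := Nat.exists_eq_add_of_le hle
        have h3 := hcell c'
        simp only
        rw [hcc, hk]
        rw [hk] at h3
        exact hrow _ _ _ h3.1 h3.2
      · rintro c c' hlt hcc
        have h3 := hcell c'
        simp only
        rw [hcc]
        exact hstr _ h3.1 _ _ hlt h3.2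
    refine ⟨fun c => G (c : ℕ × ℕ).2 (c : ℕ × ℕ).1, Finset.mem_filter.2 ⟨Finset.mem_univ _, hss⟩, ?_⟩
    funext j
    have h3 : C j = ex C j := by unfold ex; rw [dif_pos j.2]
    rw [h3, ← himg j j.2]
    unfold colF
    apply Finset.image_congr
    intro i hi
    have hi' : i < lam.colLen j := Finset.mem_range.1 hi
    exact tot_mem hn (fun c : lam.cells => G (c : ℕ × ℕ).2 (c : ℕ × ℕ).1) ⟨(i, (j : ℕ)), mem_lam hi'⟩
  · intro T hT
    have hT := (Finset.mem_filter.1 hT).2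
    rw [list_eq hn hT]

end bij

end FactorialLR

namespace FactorialLR

/-- **Hook-length formula for the specialized coefficients:**
`f^ν_{λμ} = Σ_{λ,μ ⊆ ρ ⊆ ν} (−1)^{|ν|−|ρ|} h(ρ) / (h(ν/ρ)·h(ρ/λ)·h(ρ/μ))`. -/
theorem fcoef_hook_formula (n : ℕ) (hn : 1 ≤ n) (lam mu nu : YoungDiagram)
    (hlam : lam.colLen 0 ≤ n) (hmu : mu.colLen 0 ≤ n) (hnu : nu.colLen 0 ≤ n)
    (hl : lam ≤ nu) (hm : mu ≤ nu) :
    (fcoef n lam mu nu : ℚ) =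
    ∑ᶠ rho ∈ {rho : YoungDiagram | lam ≤ rho ∧ mu ≤ rho ∧ rho ≤ nu},
      (-1 : ℚ) ^ (nu.card - rho.card) * hk ⊥ rho / (hk rho nu * hk lam rho * hk mu rho) := by
  classical
  rw [fcoef_eq_sum, sum_ssyt hn, fV_eq hlam hmu hnu]
  have hfin : {rho : YoungDiagram | lam ≤ rho ∧ mu ≤ rho ∧ rho ≤ nu}.Finite :=
    (below nu).finite_toSet.subset fun ρ h => mem_below.2 h.2.2
  rw [finsum_mem_eq_finite_toFinset_sum _ hfin]
  symm
  refine Finset.sum_subset_zero_on_sdiff ?_ ?_ ?_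
  · intro ρ hρ
    exact mem_below.2 ((Set.Finite.mem_toFinset _).1 hρ).2.2
  · intro ρ hρ
    rw [Finset.mem_sdiff, mem_below, Set.Finite.mem_toFinset] at hρ
    by_cases h1 : lam ≤ ρ
    · rw [gg_of_not (μ := mu) (ν := ρ) (fun h2 => hρ.2 ⟨h1, h2, hρ.1⟩)]; ring
    · rw [gg_of_not h1]; ring
  · intro ρ hρ
    obtain ⟨h1, h2, h3⟩ := (Set.Finite.mem_toFinset _).1 hρ
    rw [gg_of_le h1, gg_of_le h2, gg_of_le h3, gg_of_le (bot_le : ⊥ ≤ ρ), inv_inv, div_eq_mul_inv,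
      mul_inv, mul_inv]
    ring
end FactorialLR
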